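/- arXiv:2510.02900 — 18 statements merged into one kernel-verified Lean document; each statement's English description precedes it below -/
import Mathlib

section
/- Let λ ∈ ℂ and v ∈ ℂⁿ with v ≠ 0. Then (λ, v) solves the NEPv, i.e. A *ᵥ v = λ·(B *ᵥ v) + ((v*Pv)/(v*Qv))·(C *ᵥ v), if and only if there exists μ ∈ ℂ such that M(λ,μ) *ᵥ v = 0 and v*S(μ)v = 0. Moreover, any such μ necessarily equals (v*Pv)/(v*Qv). -/
open Matrix
open scoped ComplexOrder

theorem stmt_0 (n : ℕ) (hn : 0 < n)
    (A B C P Q : Matrix (Fin n) (Fin n) ℂ)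
    (hA : A.IsHermitian) (hC : C.IsHermitian) (hP : P.IsHermitian)
    (hB : B.PosDef) (hQ : Q.PosDef)
    (lam : ℂ) (v : Fin n → ℂ) (hv : v ≠ 0) :
    ((A.mulVec v = lam • B.mulVec v +
        ((star v ⬝ᵥ P.mulVec v) / (star v ⬝ᵥ Q.mulVec v)) • C.mulVec v) ↔
      ∃ μ : ℂ, (A - lam • B - μ • C).mulVec v = 0 ∧
        star v ⬝ᵥ (P - μ • Q).mulVec v = 0) ∧
    (∀ μ : ℂ, (A - lam • B - μ • C).mulVec v = 0 →
      star v ⬝ᵥ (P - μ • Q).mulVec v = 0 →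
      μ = (star v ⬝ᵥ P.mulVec v) / (star v ⬝ᵥ Q.mulVec v)) := by
  have hq : star v ⬝ᵥ Q.mulVec v ≠ 0 := (hQ.dotProduct_mulVec_pos hv).ne'
  have hM (μ : ℂ) : (A - lam • B - μ • C).mulVec v = 0 ↔
      A.mulVec v = lam • B.mulVec v + μ • C.mulVec v := by
    rw [sub_mulVec, sub_mulVec, smul_mulVec, smul_mulVec, sub_sub, sub_eq_zero]
  have hS (μ : ℂ) : star v ⬝ᵥ (P - μ • Q).mulVec v = 0 ↔
      μ = (star v ⬝ᵥ P.mulVec v) / (star v ⬝ᵥ Q.mulVec v) := by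
    rw [sub_mulVec, smul_mulVec, dotProduct_sub, dotProduct_smul, smul_eq_mul, sub_eq_zero,
      eq_div_iff hq, eq_comm]
  simp only [hM, hS, exists_eq_right, true_and]
  exact fun _ _ h => h
end

section
/- Let λ, μ ∈ ℂ and v ∈ ℂⁿ with v ≠ 0 satisfy M(λ,μ) *ᵥ v = 0 and v*S(μ)v = 0. Then both λ and μ are real-valued, i.e. have zero imaginary part. -/
open Matrix
open scoped ComplexOrder

/-- A complex scalar `z` with `z * (v* B v)` real, for `B` positive definite and `v ≠ 0`, is real. -/
lemma Matrix.PosDef.im_eq_zero_of_im_mul_eq_zero {ι : Type*} [Fintype ι] {B : Matrix ι ι ℂ}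
    (hB : B.PosDef) {v : ι → ℂ} (hv : v ≠ 0) {z : ℂ}
    (h : (z * (star v ⬝ᵥ B *ᵥ v)).im = 0) : z.im = 0 := by
  obtain ⟨hre, him⟩ := Complex.pos_iff.mp (hB.dotProduct_mulVec_pos hv)
  rw [Complex.mul_im, ← him, mul_zero, zero_add] at h
  exact (mul_eq_zero.mp h).resolve_right hre.ne'

theorem stmt_1 (n : ℕ) (hn : 0 < n)
    (A B C P Q : Matrix (Fin n) (Fin n) ℂ)
    (hA : A.IsHermitian) (hC : C.IsHermitian) (hP : P.IsHermitian)
    (hB : B.PosDef) (hQ : Q.PosDef)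
    (lam μ : ℂ) (v : Fin n → ℂ) (hv : v ≠ 0)
    (hM : (A - lam • B - μ • C).mulVec v = 0)
    (hS : star v ⬝ᵥ (P - μ • Q).mulVec v = 0) :
    lam.im = 0 ∧ μ.im = 0 := by
  have hA' : (star v ⬝ᵥ A *ᵥ v).im = 0 := hA.im_star_dotProduct_mulVec_self v
  have hC' : (star v ⬝ᵥ C *ᵥ v).im = 0 := hC.im_star_dotProduct_mulVec_self v
  have hP' : (star v ⬝ᵥ P *ᵥ v).im = 0 := hP.im_star_dotProduct_mulVec_self v
  have hM' := congrArg (star v ⬝ᵥ ·) hM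
  simp only [sub_mulVec, smul_mulVec, dotProduct_sub, dotProduct_smul, smul_eq_mul,
    dotProduct_zero] at hM' hS
  have hμ : μ.im = 0 := by
    refine hQ.im_eq_zero_of_im_mul_eq_zero hv ?_
    rw [← sub_eq_zero.mp hS, hP']
  refine ⟨hB.im_eq_zero_of_im_mul_eq_zero hv ?_, hμ⟩
  rw [sub_right_comm] at hM'
  rw [← sub_eq_zero.mp hM', Complex.sub_im, Complex.mul_im, hA', hC', hμ]
  simp
end

section
/- Let λ, μ ∈ ℂ be real-valued (zero imaginary part) and let v ∈ ℂⁿ with v ≠ 0 satisfy M(λ,μ) *ᵥ v = 0 and v*S(μ)v = 0. Then det(M(λ,μ)) = 0 and trace(S(μ) * adjugate(M(λ,μ))) = 0. -/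
open Matrix
open scoped ComplexOrder

section AdjugateTrace

variable {ι 𝕜 : Type*} [Fintype ι] [DecidableEq ι]

theorem Matrix.adjugate_conj_of_mul_eq_one {R : Type*} [CommRing R] {U V : Matrix ι ι R}
    (hUV : U * V = 1) (D : Matrix ι ι R) :
    (U * D * V).adjugate = U * D.adjugate * V := by
  have hVU : V * U = 1 := mul_eq_one_comm.mp hUV
  have hU : U.adjugate = U.det • V := by
    calc U.adjugate = V * U * U.adjugate := by rw [hVU, one_mul]
      _ = U.det • V := by rw [mul_assoc, mul_adjugate, Matrix.mul_smul, mul_one]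
  have hV : V.adjugate = V.det • U := by
    calc V.adjugate = U * V * V.adjugate := by rw [hUV, one_mul]
      _ = V.det • U := by rw [mul_assoc, mul_adjugate, Matrix.mul_smul, mul_one]
  have hdet : V.det * U.det = 1 := by rw [← det_mul, hVU, det_one]
  rw [adjugate_mul_distrib, adjugate_mul_distrib, hU, hV, smul_mul,
    Matrix.mul_smul, Matrix.mul_smul, smul_smul, hdet, one_smul, mul_assoc]

theorem Matrix.trace_mul_adjugate_diagonal_eq_zero [Field 𝕜] [StarRing 𝕜]
    {d w : ι → 𝕜} (hw : w ≠ 0) (hd : diagonal d *ᵥ w = 0) {T : Matrix ι ι 𝕜}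
    (hT : star w ⬝ᵥ T *ᵥ w = 0) :
    (T * (diagonal d).adjugate).trace = 0 := by
  have hdw (j : ι) : d j * w j = 0 := by
    rw [← mulVec_diagonal, hd, Pi.zero_apply]
  rw [adjugate_diagonal, trace]
  refine Finset.sum_eq_zero fun i _ => ?_
  rw [diag_apply, mul_diagonal, mul_eq_zero, or_iff_not_imp_right]
  intro he
  have hsingle : w = Pi.single i (w i) := by
    ext j
    rcases eq_or_ne j i with rfl | hj
    · simp
    · rw [Pi.single_eq_of_ne hj]
      exact (mul_eq_zero.mp (hdw j)).resolve_left
        (Finset.prod_ne_zero_iff.mp he j (Finset.mem_erase.mpr ⟨hj, Finset.mem_univ j⟩))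
  have hwi : w i ≠ 0 := fun h => hw (by rw [hsingle, h, Pi.single_zero])
  rw [hsingle, ← Pi.single_star, single_dotProduct, mulVec_single] at hT
  simpa [hwi] using hT

theorem Matrix.IsHermitian.trace_mul_adjugate_eq_zero [RCLike 𝕜] {M S : Matrix ι ι 𝕜}
    (hM : M.IsHermitian) {v : ι → 𝕜} (hv : v ≠ 0) (hMv : M *ᵥ v = 0)
    (hS : star v ⬝ᵥ S *ᵥ v = 0) :
    (S * M.adjugate).trace = 0 := by
  obtain ⟨U, d, hUU, hMU⟩ : ∃ (U : Matrix ι ι 𝕜) (d : ι → 𝕜),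
      U * Uᴴ = 1 ∧ M = U * diagonal d * Uᴴ :=
    ⟨hM.eigenvectorUnitary, _, Unitary.coe_mul_star_self _, hM.spectral_theorem⟩
  have hUU' : Uᴴ * U = 1 := mul_eq_one_comm.mp hUU
  have hUv : U *ᵥ (Uᴴ *ᵥ v) = v := by rw [mulVec_mulVec, hUU, one_mulVec]
  have hw : Uᴴ *ᵥ v ≠ 0 := fun h => hv (by rw [← hUv, h, mulVec_zero])
  have hd : diagonal d *ᵥ (Uᴴ *ᵥ v) = 0 := by
    calc diagonal d *ᵥ (Uᴴ *ᵥ v) = (Uᴴ * U) *ᵥ (diagonal d *ᵥ (Uᴴ *ᵥ v)) := by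
          rw [hUU', one_mulVec]
      _ = Uᴴ *ᵥ (M *ᵥ v) := by simp only [hMU, mulVec_mulVec, mul_assoc]
      _ = 0 := by rw [hMv, mulVec_zero]
  have hT : star (Uᴴ *ᵥ v) ⬝ᵥ (Uᴴ * S * U) *ᵥ (Uᴴ *ᵥ v) = 0 := by
    rw [star_mulVec, conjTranspose_conjTranspose, ← dotProduct_mulVec, ← mulVec_mulVec, hUv,
      mulVec_mulVec, ← mul_assoc, hUU, one_mul, hS]
  rw [hMU, adjugate_conj_of_mul_eq_one hUU, ← mul_assoc, trace_mul_comm, ← mul_assoc, ← mul_assoc]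
  exact trace_mul_adjugate_diagonal_eq_zero hw hd hT

end AdjugateTrace

theorem stmt_2 (n : ℕ) (hn : 0 < n)
    (A B C P Q : Matrix (Fin n) (Fin n) ℂ)
    (hA : A.IsHermitian) (hC : C.IsHermitian) (hP : P.IsHermitian)
    (hB : B.PosDef) (hQ : Q.PosDef)
    (lam μ : ℂ) (hlam : lam.im = 0) (hμ : μ.im = 0)
    (v : Fin n → ℂ) (hv : v ≠ 0)
    (hM : (A - lam • B - μ • C).mulVec v = 0)
    (hS : star v ⬝ᵥ (P - μ • Q).mulVec v = 0) :
    (A - lam • B - μ • C).det = 0 ∧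
    ((P - μ • Q) * (A - lam • B - μ • C).adjugate).trace = 0 := by
  have hherm : (A - lam • B - μ • C).IsHermitian :=
    (hA.sub (hB.isHermitian.smul (Complex.conj_eq_iff_im.mpr hlam))).sub
      (hC.smul (Complex.conj_eq_iff_im.mpr hμ))
  exact ⟨exists_mulVec_eq_zero_iff.mp ⟨v, hv, hM⟩, hherm.trace_mul_adjugate_eq_zero hv hM hS⟩
end

section
/- Let λ, μ ∈ ℂ be real-valued with det(M(λ,μ)) = 0 and trace(S(μ) * adjugate(M(λ,μ))) = 0. Let k ≥ 1 and let V be an n×k complex matrix whose columns form a basis of the null space of M(λ,μ) (the associated linear map is injective and its range equals the kernel of M(λ,μ)), and set Ŝ = Vᴴ * S(μ) * V, a Hermitian k×k matrix. Then there exists a nonzero v ∈ ℂⁿ with M(λ,μ) *ᵥ v = 0 and v*S(μ)v = 0 if and only if neither Ŝ nor −Ŝ is positive definite. -/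
open Matrix
open scoped ComplexOrder

theorem Matrix.IsHermitian.exists_dotProduct_mulVec_nonpos {m : Type*} [Fintype m]
    {H : Matrix m m ℂ} (hH : H.IsHermitian) (h : ¬ H.PosDef) :
    ∃ x : m → ℂ, x ≠ 0 ∧ (star x ⬝ᵥ H *ᵥ x).re ≤ 0 := by
  by_contra! hpos
  refine h (.of_dotProduct_mulVec_pos hH fun x hx => ?_)
  exact Complex.pos_iff.mpr ⟨hpos x hx, (hH.im_star_dotProduct_mulVec_self x).symm⟩

theorem Matrix.re_dotProduct_mulVec_add_smul {m : Type*} [Fintype m] (H : Matrix m m ℂ)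
    (x y : m → ℂ) (t : ℝ) :
    (star (x + (t : ℂ) • y) ⬝ᵥ H *ᵥ (x + (t : ℂ) • y)).re =
      (star y ⬝ᵥ H *ᵥ y).re * (t * t) +
        (star x ⬝ᵥ H *ᵥ y + star y ⬝ᵥ H *ᵥ x).re * t + (star x ⬝ᵥ H *ᵥ x).re := by
  simp only [star_add, star_smul, mulVec_add, mulVec_smul, dotProduct_add, add_dotProduct,
    smul_dotProduct, dotProduct_smul, smul_eq_mul, Complex.add_re, Complex.star_def,
    Complex.conj_ofReal, Complex.re_ofReal_mul]
  ring

/-- A Hermitian form that is neither positive nor negative definite is isotropic. -/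
theorem Matrix.IsHermitian.exists_dotProduct_mulVec_eq_zero {m : Type*} [Fintype m]
    {H : Matrix m m ℂ} (hH : H.IsHermitian) (hpos : ¬ H.PosDef) (hneg : ¬ (-H).PosDef) :
    ∃ x : m → ℂ, x ≠ 0 ∧ star x ⬝ᵥ H *ᵥ x = 0 := by
  suffices ∃ x : m → ℂ, x ≠ 0 ∧ (star x ⬝ᵥ H *ᵥ x).re = 0 by
    obtain ⟨x, hx, hre⟩ := this
    exact ⟨x, hx, Complex.ext hre (hH.im_star_dotProduct_mulVec_self x)⟩
  obtain ⟨x, hx, hqx⟩ := hH.exists_dotProduct_mulVec_nonpos hpos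
  obtain ⟨y, hy, hqy⟩ := hH.neg.exists_dotProduct_mulVec_nonpos hneg
  simp only [neg_mulVec, dotProduct_neg, Complex.neg_re, Left.neg_nonpos_iff] at hqy
  rcases hqx.eq_or_lt with hqx | hqx
  · exact ⟨x, hx, hqx⟩
  rcases hqy.eq_or_lt with hqy | hqy
  · exact ⟨y, hy, hqy.symm⟩
  set a := (star y ⬝ᵥ H *ᵥ y).re
  set b := (star x ⬝ᵥ H *ᵥ y + star y ⬝ᵥ H *ᵥ x).re
  set c := (star x ⬝ᵥ H *ᵥ x).re with hc
  have hdiscrim : 0 ≤ discrim a b c := by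
    unfold discrim
    nlinarith [sq_nonneg b, mul_pos hqy (neg_pos.mpr hqx)]
  obtain ⟨t, ht⟩ := exists_quadratic_eq_zero hqy.ne' ⟨_, (Real.mul_self_sqrt hdiscrim).symm⟩
  refine ⟨x + (t : ℂ) • y, fun h0 => ?_, (re_dotProduct_mulVec_add_smul H x y t).trans ht⟩
  have hxy : x = 0 + ((-t : ℝ) : ℂ) • y := by
    rw [eq_neg_of_add_eq_zero_left h0]
    simp
  have hcy : c = a * (-t * -t) := by
    rw [hc, hxy, re_dotProduct_mulVec_add_smul]
    simp [a]
  nlinarith [mul_nonneg hqy.le (mul_self_nonneg t)]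

theorem Matrix.dotProduct_conjTranspose_mul_mul_mulVec {m n : Type*} [Fintype m] [Fintype n]
    (V : Matrix n m ℂ) (S : Matrix n n ℂ) (w : m → ℂ) :
    star w ⬝ᵥ (Vᴴ * S * V) *ᵥ w = star (V *ᵥ w) ⬝ᵥ S *ᵥ (V *ᵥ w) := by
  rw [star_mulVec, ← dotProduct_mulVec, mulVec_mulVec, mulVec_mulVec, Matrix.mul_assoc]

theorem stmt_3 (n : ℕ) (hn : 0 < n)
    (A B C P Q : Matrix (Fin n) (Fin n) ℂ)
    (hA : A.IsHermitian) (hC : C.IsHermitian) (hP : P.IsHermitian)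
    (hB : B.PosDef) (hQ : Q.PosDef)
    (lam μ : ℂ) (hlam : lam.im = 0) (hμ : μ.im = 0)
    (hdet : (A - lam • B - μ • C).det = 0)
    (htr : ((P - μ • Q) * (A - lam • B - μ • C).adjugate).trace = 0)
    (k : ℕ) (hk : 1 ≤ k) (V : Matrix (Fin n) (Fin k) ℂ)
    (hVinj : Function.Injective V.mulVec)
    (hVrange : LinearMap.range V.mulVecLin =
      LinearMap.ker (A - lam • B - μ • C).mulVecLin) :
    (∃ v : Fin n → ℂ, v ≠ 0 ∧ (A - lam • B - μ • C).mulVec v = 0 ∧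
        star v ⬝ᵥ (P - μ • Q).mulVec v = 0) ↔
      (¬ (Vᴴ * (P - μ • Q) * V).PosDef ∧ ¬ (-(Vᴴ * (P - μ • Q) * V)).PosDef) := by
  have hS : (P - μ • Q).IsHermitian :=
    hP.sub (hQ.isHermitian.smul (Complex.conj_eq_iff_im.mpr hμ))
  have hker (v : Fin n → ℂ) :
      (A - lam • B - μ • C).mulVec v = 0 ↔ ∃ w, V.mulVec w = v :=
    (SetLike.ext_iff.mp hVrange v).symm
  have hV0 (w : Fin k → ℂ) : V.mulVec w = 0 ↔ w = 0 :=
    ⟨fun h => hVinj (h.trans (mulVec_zero V).symm), fun h => h ▸ mulVec_zero V⟩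
  constructor
  · rintro ⟨v, hv, hMv, hSv⟩
    obtain ⟨w, rfl⟩ := (hker v).mp hMv
    have hw : w ≠ 0 := mt (hV0 w).mpr hv
    rw [← dotProduct_conjTranspose_mul_mul_mulVec] at hSv
    refine ⟨fun h => (h.dotProduct_mulVec_pos hw).ne' hSv,
      fun h => (h.dotProduct_mulVec_pos hw).ne' ?_⟩
    rw [neg_mulVec, dotProduct_neg, hSv, neg_zero]
  · rintro ⟨hpos, hneg⟩
    obtain ⟨w, hw, hqw⟩ :=
      (isHermitian_conjTranspose_mul_mul V hS).exists_dotProduct_mulVec_eq_zero hpos hneg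
    exact ⟨V.mulVec w, mt (hV0 w).mp hw, (hker _).mpr ⟨w, rfl⟩,
      (dotProduct_conjTranspose_mul_mul_mulVec V _ w).symm.trans hqw⟩
end

section
/- Let λ, μ ∈ ℂ be real-valued with det(M(λ,μ)) = 0 and trace(S(μ) * adjugate(M(λ,μ))) = 0, and suppose the null space of M(λ,μ) is one-dimensional (rank M(λ,μ) = n − 1). Then there exists a nonzero v ∈ ℂⁿ with M(λ,μ) *ᵥ v = 0 and v*S(μ)v = 0. -/
open Matrix
open scoped ComplexOrder

namespace Matrix

variable {ι 𝕜 : Type*} [Fintype ι] [DecidableEq ι] [RCLike 𝕜]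

/-- The adjugate commutes with conjugation by an invertible matrix. -/
theorem adjugate_conj_of_mul_eq_one_s4 {R : Type*} [CommRing R] {U V : Matrix ι ι R}
    (h : V * U = 1) (D : Matrix ι ι R) : (U * D * V).adjugate = U * D.adjugate * V := by
  have hdet : V.det * U.det = 1 := by rw [← det_mul, h, det_one]
  have hU : U.adjugate = U.det • V := by
    calc U.adjugate = U.adjugate * (U * V) := by rw [mul_eq_one_comm.mp h, mul_one]
      _ = U.det • V := by rw [← mul_assoc, adjugate_mul, smul_mul, one_mul]
  have hV : V.adjugate = V.det • U := by
    calc V.adjugate = V.adjugate * (V * U) := by rw [h, mul_one]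
      _ = V.det • U := by rw [← mul_assoc, adjugate_mul, smul_mul, one_mul]
  rw [adjugate_mul_distrib, adjugate_mul_distrib, hU, hV, smul_mul, Matrix.mul_smul,
    Matrix.mul_smul, smul_smul, hdet, one_smul, mul_assoc]

namespace IsHermitian

variable {A : Matrix ι ι 𝕜}

/-- A Hermitian matrix of corank one has exactly one vanishing eigenvalue. -/
theorem existsUnique_eigenvalues_eq_zero (hA : A.IsHermitian)
    (hrank : A.rank + 1 = Fintype.card ι) : ∃! i, hA.eigenvalues i = 0 := by
  rw [hA.rank_eq_card_non_zero_eigs, Fintype.card_subtype_compl] at hrank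
  have hle := Fintype.card_subtype_le fun i ↦ hA.eigenvalues i = 0
  obtain ⟨⟨i, hi⟩, huniq⟩ :=
    Fintype.card_eq_one_iff.mp (show Fintype.card {i // hA.eigenvalues i = 0} = 1 by omega)
  exact ⟨i, hi, fun j hj ↦ congrArg Subtype.val (huniq ⟨j, hj⟩)⟩

/-- If the `i`-th eigenvalue of a Hermitian matrix vanishes, its adjugate is the product of the
other eigenvalues times the projection onto the `i`-th eigenvector. -/
theorem adjugate_eq_smul_vecMulVec (hA : A.IsHermitian) {i : ι} (hi : hA.eigenvalues i = 0) :
    A.adjugate = (∏ j ∈ Finset.univ.erase i, (hA.eigenvalues j : 𝕜)) •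
      vecMulVec (hA.eigenvectorBasis i) (star ⇑(hA.eigenvectorBasis i)) := by
  have hdiag : (diagonal fun k ↦ ∏ j ∈ Finset.univ.erase k, (hA.eigenvalues j : 𝕜)) =
      (∏ j ∈ Finset.univ.erase i, (hA.eigenvalues j : 𝕜)) •
        vecMulVec (Pi.single i 1) (star (Pi.single i 1)) := by
    have hzero (k : ι) (hk : k ≠ i) :
        ∏ j ∈ Finset.univ.erase k, (hA.eigenvalues j : 𝕜) = 0 :=
      Finset.prod_eq_zero (Finset.mem_erase.mpr ⟨hk.symm, Finset.mem_univ i⟩) (by simp [hi])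
    ext k l
    by_cases hk : k = i
    · subst hk
      by_cases hl : k = l
      · subst hl
        simp [vecMulVec_apply]
      · simp [vecMulVec_apply, hl, Ne.symm hl]
    · simp [vecMulVec_apply, diagonal_apply, hk, hzero k hk]
  conv_lhs => rw [hA.spectral_theorem, Unitary.conjStarAlgAut_apply,
    adjugate_conj_of_mul_eq_one_s4 (Unitary.coe_star_mul_self _), adjugate_diagonal]
  simp only [Function.comp_apply]
  rw [hdiag, Matrix.mul_smul, smul_mul, mul_vecMulVec, vecMulVec_mul, star_eq_conjTranspose,
    ← star_mulVec, eigenvectorUnitary_mulVec]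

end IsHermitian

end Matrix

theorem stmt_4 (n : ℕ) (hn : 0 < n)
    (A B C P Q : Matrix (Fin n) (Fin n) ℂ)
    (hA : A.IsHermitian) (hC : C.IsHermitian) (hP : P.IsHermitian)
    (hB : B.PosDef) (hQ : Q.PosDef)
    (lam μ : ℂ) (hlam : lam.im = 0) (hμ : μ.im = 0)
    (hdet : (A - lam • B - μ • C).det = 0)
    (htr : ((P - μ • Q) * (A - lam • B - μ • C).adjugate).trace = 0)
    (hrank : (A - lam • B - μ • C).rank = n - 1) :
    ∃ v : Fin n → ℂ, v ≠ 0 ∧ (A - lam • B - μ • C).mulVec v = 0 ∧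
      star v ⬝ᵥ (P - μ • Q).mulVec v = 0 := by
  have hM : (A - lam • B - μ • C).IsHermitian :=
    (hA.sub (hB.isHermitian.smul (Complex.conj_eq_iff_im.mpr hlam))).sub
      (hC.smul (Complex.conj_eq_iff_im.mpr hμ))
  obtain ⟨i, hi, huniq⟩ := hM.existsUnique_eigenvalues_eq_zero
    (by rw [hrank, Fintype.card_fin]; omega)
  refine ⟨hM.eigenvectorBasis i, fun h ↦ ?_, ?_, ?_⟩
  · exact hM.eigenvectorBasis.orthonormal.ne_zero i (PiLp.ext fun j ↦ congrFun h j)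
  · rw [hM.mulVec_eigenvectorBasis, hi, zero_smul]
  · rw [hM.adjugate_eq_smul_vecMulVec hi, Matrix.mul_smul, trace_smul, mul_vecMulVec,
      trace_vecMulVec, dotProduct_comm, smul_eq_mul] at htr
    refine (mul_eq_zero.mp htr).resolve_left (Finset.prod_ne_zero_iff.mpr fun j hj ↦ ?_)
    exact RCLike.ofReal_ne_zero.mpr fun h ↦ Finset.ne_of_mem_erase hj (huniq j h)
end

section
/- If (λ, v) solves the NEPv with v ≠ 0, then there exist μ ∈ ℂ with zero imaginary part, a vector w₁ ∈ ℂ^{n−1} and a scalar α ∈ ℂ such that the vector w = (w₁, α·v) ∈ ℂ^{n−1} ⊕ ℂⁿ is nonzero and (λ, μ, v, w) solves the MEP: A *ᵥ v = λ·(B *ᵥ v) + μ·(C *ᵥ v) and Â *ᵥ w = λ·(B̂ *ᵥ w) + μ·(Ĉ *ᵥ w). -/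
open Matrix
open scoped ComplexOrder

theorem Matrix.IsHermitian.conj_star_dotProduct_mulVec {m : Type*} [Fintype m]
    {A : Matrix m m ℂ} (hA : A.IsHermitian) (x : m → ℂ) :
    star (star x ⬝ᵥ A *ᵥ x) = star x ⬝ᵥ A *ᵥ x := by
  rw [← star_dotProduct_star, star_star, star_mulVec, hA.eq, ← dotProduct_mulVec]

/-- If the range of `N` and the vector `s` are both orthogonal to a nonzero vector `v`, and `N`
has one column fewer than rows, then `N` augmented by `s` has a nontrivial kernel. -/
theorem Matrix.exists_mulVec_add_smul_eq_zero {n : ℕ} (hn : 0 < n)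
    (N : Matrix (Fin n) (Fin (n - 1)) ℂ) (s : Fin n → ℂ) {v : Fin n → ℂ} (hv : v ≠ 0)
    (hN : star v ᵥ* N = 0) (hs : star v ⬝ᵥ s = 0) :
    ∃ (w : Fin (n - 1) → ℂ) (α : ℂ), (w, α) ≠ 0 ∧ N *ᵥ w + α • s = 0 := by
  let T : (Fin (n - 1) → ℂ) × ℂ →ₗ[ℂ] Fin n → ℂ :=
    N.mulVecLin.coprod (LinearMap.toSpanSingleton ℂ _ s)
  have hT : ¬ Function.Injective T := by
    intro hinj
    have hdim : Module.finrank ℂ ((Fin (n - 1) → ℂ) × ℂ) = Module.finrank ℂ (Fin n → ℂ) := by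
      simp
      omega
    obtain ⟨⟨w, α⟩, hw⟩ :=
      (LinearMap.injective_iff_surjective_of_finrank_eq_finrank hdim).mp hinj v
    apply hv
    rw [← dotProduct_star_self_eq_zero]
    nth_rewrite 2 [← hw]
    simp [T, dotProduct_add, dotProduct_mulVec, hN, hs]
  rw [← LinearMap.ker_eq_bot, Submodule.eq_bot_iff] at hT
  push Not at hT
  obtain ⟨⟨w, α⟩, hw, hne⟩ := hT
  exact ⟨w, α, hne, by simpa [T] using hw⟩

theorem stmt_6 (n : ℕ) (hn : 0 < n)
    (A B C P Q : Matrix (Fin n) (Fin n) ℂ)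
    (hA : A.IsHermitian) (hC : C.IsHermitian) (hP : P.IsHermitian)
    (hB : B.PosDef) (hQ : Q.PosDef)
    (R : Matrix (Fin n) (Fin (n - 1)) ℂ) (hR : Function.Injective R.mulVec)
    (Ahat : Matrix (Fin (n - 1) ⊕ Fin n) (Fin (n - 1) ⊕ Fin n) ℂ)
    (hAhat : Ahat = Matrix.fromBlocks 0 (Rᴴ * A) (A * R) P)
    (Bhat : Matrix (Fin (n - 1) ⊕ Fin n) (Fin (n - 1) ⊕ Fin n) ℂ)
    (hBhat : Bhat = Matrix.fromBlocks 0 (Rᴴ * B) (B * R) 0)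
    (Chat : Matrix (Fin (n - 1) ⊕ Fin n) (Fin (n - 1) ⊕ Fin n) ℂ)
    (hChat : Chat = Matrix.fromBlocks 0 (Rᴴ * C) (C * R) Q)
    (lam : ℂ) (v : Fin n → ℂ) (hv : v ≠ 0)
    (hNEPv : A.mulVec v = lam • B.mulVec v +
      ((star v ⬝ᵥ P.mulVec v) / (star v ⬝ᵥ Q.mulVec v)) • C.mulVec v) :
    ∃ (μ : ℂ) (w₁ : Fin (n - 1) → ℂ) (α : ℂ),
      μ.im = 0 ∧
      Sum.elim w₁ (α • v) ≠ 0 ∧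
      A.mulVec v = lam • B.mulVec v + μ • C.mulVec v ∧
      Ahat.mulVec (Sum.elim w₁ (α • v)) =
        lam • Bhat.mulVec (Sum.elim w₁ (α • v)) +
          μ • Chat.mulVec (Sum.elim w₁ (α • v)) := by
  set μ := (star v ⬝ᵥ P *ᵥ v) / (star v ⬝ᵥ Q *ᵥ v) with hμ
  have hQv : star v ⬝ᵥ Q *ᵥ v ≠ 0 := (hQ.dotProduct_mulVec_pos hv).ne'
  have hBv : star v ⬝ᵥ B *ᵥ v ≠ 0 := (hB.dotProduct_mulVec_pos hv).ne'
  have hμ_real : star μ = μ := by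
    rw [hμ, star_div₀, hP.conj_star_dotProduct_mulVec, hQ.isHermitian.conj_star_dotProduct_mulVec]
  have hlam_real : star lam = lam := by
    have h : lam = (star v ⬝ᵥ A *ᵥ v - μ * (star v ⬝ᵥ C *ᵥ v)) / (star v ⬝ᵥ B *ᵥ v) := by
      rw [eq_div_iff hBv, hNEPv]
      simp [dotProduct_add]
    rw [h, star_div₀, star_sub, star_mul', hA.conj_star_dotProduct_mulVec, hμ_real,
      hC.conj_star_dotProduct_mulVec, hB.isHermitian.conj_star_dotProduct_mulVec]
  have hM : (A - lam • B - μ • C).IsHermitian := by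
    simp only [IsHermitian, conjTranspose_sub, conjTranspose_smul, hA.eq, hB.isHermitian.eq,
      hC.eq, hlam_real, hμ_real]
  have hMv : (A - lam • B - μ • C) *ᵥ v = 0 := by
    simp [sub_mulVec, smul_mulVec, hNEPv]
  have hvM : star v ᵥ* (A - lam • B - μ • C) = 0 := by
    rw [← hM.eq, ← star_mulVec, hMv, star_zero]
  have hvS : star v ⬝ᵥ (P - μ • Q) *ᵥ v = 0 := by
    simp [sub_mulVec, smul_mulVec, dotProduct_sub, hμ, hQv]
  obtain ⟨w, α, hne, hw⟩ := exists_mulVec_add_smul_eq_zero hn ((A - lam • B - μ • C) * R)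
    ((P - μ • Q) *ᵥ v) hv (by rw [← vecMul_vecMul, hvM, zero_vecMul]) hvS
  refine ⟨μ, w, α, Complex.conj_eq_iff_im.mp hμ_real, ?_, hNEPv, ?_⟩
  · intro h
    apply hne
    have hw0 : w = 0 := funext fun i => congrFun h (Sum.inl i)
    have hαv : α • v = 0 := funext fun i => congrFun h (Sum.inr i)
    rw [hw0, (smul_eq_zero.mp hαv).resolve_right hv, Prod.mk_zero_zero]
  · have htop : (Rᴴ * A) *ᵥ v = lam • (Rᴴ * B) *ᵥ v + μ • (Rᴴ * C) *ᵥ v := by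
      simp only [← mulVec_mulVec, hNEPv, mulVec_add, mulVec_smul]
    have hbot : (A * R) *ᵥ w + α • P *ᵥ v =
        lam • (B * R) *ᵥ w + μ • ((C * R) *ᵥ w + α • Q *ᵥ v) := by
      rw [← sub_eq_zero, ← hw]
      simp only [Matrix.sub_mul, Matrix.smul_mul, sub_mulVec, smul_mulVec]
      module
    subst hAhat hBhat hChat
    simp only [fromBlocks_mulVec, Sum.elim_comp_inl, Sum.elim_comp_inr, zero_mulVec, zero_add,
      mulVec_smul, htop, hbot]
    ext (i | i) <;> simp <;> ring
end

section
/- Let λ, μ ∈ ℂ be real-valued and suppose rank(M(λ,μ)) = rank(M(λ,μ) * R). Let v ∈ ℂⁿ be nonzero with M(λ,μ) *ᵥ v = 0, and let w = (w₁, w₂) ∈ ℂ^{n−1} ⊕ ℂⁿ with w₂ ≠ 0 satisfy Â *ᵥ w = λ·(B̂ *ᵥ w) + μ·(Ĉ *ᵥ w). Then (λ, w₂) solves the NEPv: A *ᵥ w₂ = λ·(B *ᵥ w₂) + ((w₂*Pw₂)/(w₂*Qw₂))·(C *ᵥ w₂). -/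
open Matrix
open scoped ComplexOrder

/-- If `M` and `M * R` have the same rank, then every vector in the range of `M` is in the range of
`M * R`. -/
theorem exists_mul_mulVec_eq_of_rank_eq {n m : ℕ} {M : Matrix (Fin n) (Fin n) ℂ}
    {R : Matrix (Fin n) (Fin m) ℂ} (h : M.rank = (M * R).rank) (x : Fin n → ℂ) :
    ∃ y, (M * R) *ᵥ y = M *ᵥ x := by
  have hle : LinearMap.range (M * R).mulVecLin ≤ LinearMap.range M.mulVecLin := by
    rw [Matrix.mulVecLin_mul]
    exact LinearMap.range_comp_le_range _ _
  have heq := Submodule.eq_of_le_of_finrank_eq hle h.symm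
  have hx : M.mulVecLin x ∈ LinearMap.range (M * R).mulVecLin := heq ▸ LinearMap.mem_range_self _ x
  simpa using hx

/-- For Hermitian `M` with `rank M = rank (M * R)`, the kernel of `Rᴴ * M` is that of `M`. -/
theorem Matrix.IsHermitian.mulVec_eq_zero_of_rank_eq {n m : ℕ} {M : Matrix (Fin n) (Fin n) ℂ}
    {R : Matrix (Fin n) (Fin m) ℂ} (hM : M.IsHermitian) (h : M.rank = (M * R).rank)
    {x : Fin n → ℂ} (hx : (Rᴴ * M) *ᵥ x = 0) : M *ᵥ x = 0 := by
  obtain ⟨y, hy⟩ := exists_mul_mulVec_eq_of_rank_eq h (M *ᵥ x)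
  have hstar : star x ᵥ* (M * R) = 0 := by
    simpa [star_mulVec, conjTranspose_mul, hM.eq] using congrArg star hx
  rw [← dotProduct_star_self_eq_zero, star_mulVec, hM.eq, ← dotProduct_mulVec,
    ← hy, dotProduct_mulVec, hstar, zero_dotProduct]

theorem stmt_7 (n : ℕ) (hn : 0 < n)
    (A B C P Q : Matrix (Fin n) (Fin n) ℂ)
    (hA : A.IsHermitian) (hC : C.IsHermitian) (hP : P.IsHermitian)
    (hB : B.PosDef) (hQ : Q.PosDef)
    (R : Matrix (Fin n) (Fin (n - 1)) ℂ) (hR : Function.Injective R.mulVec)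
    (Ahat : Matrix (Fin (n - 1) ⊕ Fin n) (Fin (n - 1) ⊕ Fin n) ℂ)
    (hAhat : Ahat = Matrix.fromBlocks 0 (Rᴴ * A) (A * R) P)
    (Bhat : Matrix (Fin (n - 1) ⊕ Fin n) (Fin (n - 1) ⊕ Fin n) ℂ)
    (hBhat : Bhat = Matrix.fromBlocks 0 (Rᴴ * B) (B * R) 0)
    (Chat : Matrix (Fin (n - 1) ⊕ Fin n) (Fin (n - 1) ⊕ Fin n) ℂ)
    (hChat : Chat = Matrix.fromBlocks 0 (Rᴴ * C) (C * R) Q)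
    (lam μ : ℂ) (hlam : lam.im = 0) (hμ : μ.im = 0)
    (hrank : (A - lam • B - μ • C).rank = ((A - lam • B - μ • C) * R).rank)
    (v : Fin n → ℂ) (hv : v ≠ 0)
    (hMv : (A - lam • B - μ • C).mulVec v = 0)
    (w₁ : Fin (n - 1) → ℂ) (w₂ : Fin n → ℂ) (hw₂ : w₂ ≠ 0)
    (hw : Ahat.mulVec (Sum.elim w₁ w₂) =
      lam • Bhat.mulVec (Sum.elim w₁ w₂) + μ • Chat.mulVec (Sum.elim w₁ w₂)) :
    A.mulVec w₂ = lam • B.mulVec w₂ +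
      ((star w₂ ⬝ᵥ P.mulVec w₂) / (star w₂ ⬝ᵥ Q.mulVec w₂)) • C.mulVec w₂ := by
  have hM : (A - lam • B - μ • C).IsHermitian := by
    have hl : IsSelfAdjoint lam := Complex.conj_eq_iff_im.mpr hlam
    have hm : IsSelfAdjoint μ := Complex.conj_eq_iff_im.mpr hμ
    exact (hA.sub (hB.isHermitian.smul hl)).sub (hC.smul hm)
  subst hAhat hBhat hChat
  have hfst : (Rᴴ * (A - lam • B - μ • C)) *ᵥ w₂ = 0 := by
    ext i
    have := congrFun hw (Sum.inl i)
    simp [fromBlocks_mulVec] at this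
    simp [Matrix.mul_sub, sub_mulVec, smul_mulVec, this]
  have hsnd : ((A - lam • B - μ • C) * R) *ᵥ w₁ + P *ᵥ w₂ = μ • Q *ᵥ w₂ := by
    ext i
    have := congrFun hw (Sum.inr i)
    simp [fromBlocks_mulVec] at this
    simp [Matrix.sub_mul, sub_mulVec, smul_mulVec]
    linear_combination this
  have hker := hM.mulVec_eq_zero_of_rank_eq hrank hfst
  have hstar : star w₂ ᵥ* (A - lam • B - μ • C) = 0 := by
    simpa [star_mulVec, hM.eq] using congrArg star hker
  have hPQ : star w₂ ⬝ᵥ P *ᵥ w₂ = μ * (star w₂ ⬝ᵥ Q *ᵥ w₂) := by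
    have := congrArg (star w₂ ⬝ᵥ ·) hsnd
    rwa [dotProduct_add, dotProduct_smul, smul_eq_mul, dotProduct_mulVec _ (_ * R),
      ← vecMul_vecMul, hstar, zero_vecMul, zero_dotProduct, zero_add] at this
  rw [hPQ, mul_div_cancel_right₀ _ (hQ.dotProduct_mulVec_pos hw₂).ne']
  rw [sub_mulVec, sub_mulVec, smul_mulVec, smul_mulVec, sub_sub] at hker
  exact sub_eq_zero.mp hker
end

section
/- Let λ, μ ∈ ℂ, let v ∈ ℂⁿ satisfy A *ᵥ v = λ·(B *ᵥ v) + μ·(C *ᵥ v), and let w ∈ ℂ^{n−1} ⊕ ℂⁿ satisfy Â *ᵥ w = λ·(B̂ *ᵥ w) + μ·(Ĉ *ᵥ w). Then the Kronecker product vector z = v ⊗ w, indexed by Fin n × (Fin(n−1) ⊕ Fin n) with z(i,j) = v i · w j, satisfies both Δ₁ *ᵥ z = λ·(Δ₀ *ᵥ z) and Δ₂ *ᵥ z = μ·(Δ₀ *ᵥ z). -/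
open Matrix
open scoped ComplexOrder Kronecker

/-- A Kronecker product of matrices acts factorwise on a Kronecker product of vectors. -/
theorem kronecker_mulVec_mul {α l m p q : Type*} [CommSemiring α] [Fintype m] [Fintype q]
    (X : Matrix l m α) (Y : Matrix p q α) (v : m → α) (w : q → α) :
    (X ⊗ₖ Y).mulVec (fun i => v i.1 * w i.2) =
      fun i => X.mulVec v i.1 * Y.mulVec w i.2 := by
  ext ⟨i, j⟩
  simp only [Matrix.mulVec, dotProduct, Matrix.kroneckerMap_apply, Fintype.sum_prod_type,
    Finset.sum_mul_sum]
  exact Finset.sum_congr rfl fun _ _ => Finset.sum_congr rfl fun _ _ => by ring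

theorem stmt_8 (n : ℕ) (hn : 0 < n)
    (A B C P Q : Matrix (Fin n) (Fin n) ℂ)
    (hA : A.IsHermitian) (hC : C.IsHermitian) (hP : P.IsHermitian)
    (hB : B.PosDef) (hQ : Q.PosDef)
    (R : Matrix (Fin n) (Fin (n - 1)) ℂ) (hR : Function.Injective R.mulVec)
    (Ahat : Matrix (Fin (n - 1) ⊕ Fin n) (Fin (n - 1) ⊕ Fin n) ℂ)
    (hAhat : Ahat = Matrix.fromBlocks 0 (Rᴴ * A) (A * R) P)
    (Bhat : Matrix (Fin (n - 1) ⊕ Fin n) (Fin (n - 1) ⊕ Fin n) ℂ)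
    (hBhat : Bhat = Matrix.fromBlocks 0 (Rᴴ * B) (B * R) 0)
    (Chat : Matrix (Fin (n - 1) ⊕ Fin n) (Fin (n - 1) ⊕ Fin n) ℂ)
    (hChat : Chat = Matrix.fromBlocks 0 (Rᴴ * C) (C * R) Q)
    (Δ₀ Δ₁ Δ₂ : Matrix (Fin n × (Fin (n - 1) ⊕ Fin n)) (Fin n × (Fin (n - 1) ⊕ Fin n)) ℂ)
    (hΔ₀ : Δ₀ = B ⊗ₖ Chat - C ⊗ₖ Bhat)
    (hΔ₁ : Δ₁ = A ⊗ₖ Chat - C ⊗ₖ Ahat)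
    (hΔ₂ : Δ₂ = B ⊗ₖ Ahat - A ⊗ₖ Bhat)
    (lam μ : ℂ) (v : Fin n → ℂ) (w : Fin (n - 1) ⊕ Fin n → ℂ)
    (hv : A.mulVec v = lam • B.mulVec v + μ • C.mulVec v)
    (hw : Ahat.mulVec w = lam • Bhat.mulVec w + μ • Chat.mulVec w) :
    Δ₁.mulVec (fun p => v p.1 * w p.2) = lam • Δ₀.mulVec (fun p => v p.1 * w p.2) ∧
    Δ₂.mulVec (fun p => v p.1 * w p.2) = μ • Δ₀.mulVec (fun p => v p.1 * w p.2) := by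
  subst hΔ₀ hΔ₁ hΔ₂
  simp only [Matrix.sub_mulVec, kronecker_mulVec_mul, hv, hw]
  constructor <;>
  · ext ⟨i, j⟩
    simp only [Pi.sub_apply, Pi.add_apply, Pi.smul_apply, smul_eq_mul]
    ring
end

section
/- For every λ ∈ ℂ the following are equivalent: (i) λ has zero imaginary part and there exists a nonzero z ∈ ℂ^{n−1} ⊕ ℂⁿ with Ĉ *ᵥ z = λ·(B̂ *ᵥ z); (ii) there exists a nonzero x ∈ ℂ^{n−1} with (C*R) *ᵥ x = λ·((B*R) *ᵥ x). -/
open Matrix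
open scoped ComplexOrder

/-- The eigenvalues of a Hermitian-definite matrix pencil are real. -/
theorem im_eq_zero_of_mulVec_eq_smul_mulVec {m : Type*} [Fintype m] {B C : Matrix m m ℂ}
    (hC : C.IsHermitian) (hB : B.PosDef) {lam : ℂ} {v : m → ℂ} (hv : v ≠ 0)
    (h : C *ᵥ v = lam • B *ᵥ v) : lam.im = 0 := by
  have hpos := Complex.pos_iff.1 (hB.dotProduct_mulVec_pos hv)
  have him : (star v ⬝ᵥ C *ᵥ v).im = 0 := hC.im_star_dotProduct_mulVec_self v
  rw [h, dotProduct_smul, smul_eq_mul, Complex.mul_im, ← hpos.2, mul_zero, zero_add] at him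
  exact (mul_eq_zero.1 him).resolve_right hpos.1.ne'

/-- A saddle-point system with definite lower right block has vanishing second component. -/
theorem eq_zero_of_conjTranspose_mulVec_eq_zero {m k : Type*} [Fintype m] [Fintype k]
    {K : Matrix m k ℂ} {Q : Matrix m m ℂ} (hQ : Q.PosDef) {x : k → ℂ} {y : m → ℂ}
    (h₁ : Kᴴ *ᵥ y = 0) (h₂ : K *ᵥ x + Q *ᵥ y = 0) : y = 0 := by
  by_contra hy
  have hK : star y ⬝ᵥ K *ᵥ x = 0 := by
    rw [dotProduct_mulVec, ← conjTranspose_conjTranspose K, ← star_mulVec, h₁, star_zero,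
      zero_dotProduct]
  have hsum := congrArg (star y ⬝ᵥ ·) h₂
  simp only [dotProduct_add, hK, zero_add, dotProduct_zero] at hsum
  exact (hQ.dotProduct_mulVec_pos hy).ne' hsum

theorem stmt_9 (n : ℕ) (hn : 0 < n)
    (A B C P Q : Matrix (Fin n) (Fin n) ℂ)
    (hA : A.IsHermitian) (hC : C.IsHermitian) (hP : P.IsHermitian)
    (hB : B.PosDef) (hQ : Q.PosDef)
    (R : Matrix (Fin n) (Fin (n - 1)) ℂ) (hR : Function.Injective R.mulVec)
    (Bhat : Matrix (Fin (n - 1) ⊕ Fin n) (Fin (n - 1) ⊕ Fin n) ℂ)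
    (hBhat : Bhat = Matrix.fromBlocks 0 (Rᴴ * B) (B * R) 0)
    (Chat : Matrix (Fin (n - 1) ⊕ Fin n) (Fin (n - 1) ⊕ Fin n) ℂ)
    (hChat : Chat = Matrix.fromBlocks 0 (Rᴴ * C) (C * R) Q)
    (lam : ℂ) :
    (lam.im = 0 ∧ ∃ z : Fin (n - 1) ⊕ Fin n → ℂ, z ≠ 0 ∧
        Chat.mulVec z = lam • Bhat.mulVec z) ↔
      (∃ x : Fin (n - 1) → ℂ, x ≠ 0 ∧
        (C * R).mulVec x = lam • (B * R).mulVec x) := by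
  subst hBhat hChat
  constructor
  · rintro ⟨hlam, z, hz, h⟩
    obtain ⟨x, y, rfl⟩ : ∃ x y, z = Sum.elim x y := ⟨_, _, (Sum.elim_comp_inl_inr z).symm⟩
    have h₁ : (Rᴴ * C) *ᵥ y = lam • (Rᴴ * B) *ᵥ y := by
      ext i
      simpa [fromBlocks_mulVec] using congrFun h (Sum.inl i)
    have h₂ : (C * R) *ᵥ x + Q *ᵥ y = lam • (B * R) *ᵥ x := by
      ext i
      simpa [fromBlocks_mulVec] using congrFun h (Sum.inr i)
    have hconj : star lam = lam := Complex.conj_eq_iff_im.2 hlam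
    have hy : y = 0 := by
      refine eq_zero_of_conjTranspose_mulVec_eq_zero (K := C * R - lam • (B * R)) (x := x) hQ ?_ ?_
      · rw [conjTranspose_sub, conjTranspose_smul, conjTranspose_mul, conjTranspose_mul, hC.eq,
          hB.isHermitian.eq, hconj, sub_mulVec, smul_mulVec, h₁, sub_self]
      · rw [sub_mulVec, smul_mulVec, ← h₂]
        abel
    subst hy
    refine ⟨x, ?_, by simpa using h₂⟩
    rintro rfl
    exact hz (Sum.elim_zero_zero)
  · rintro ⟨x, hx, h⟩
    have hRx : R *ᵥ x ≠ 0 := fun h0 => hx (hR (h0.trans (mulVec_zero R).symm))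
    refine ⟨im_eq_zero_of_mulVec_eq_smul_mulVec hC hB hRx (by simpa only [mulVec_mulVec] using h),
      Sum.elim x 0, fun h0 => hx (funext fun i => congrFun h0 (Sum.inl i)), ?_⟩
    ext (i | i)
    · simp [fromBlocks_mulVec]
    · simpa [fromBlocks_mulVec] using congrFun h i
end

section
/- The operator determinant Δ₀ is singular (det Δ₀ = 0) if and only if there exist λ ∈ ℂ and a nonzero x ∈ ℂ^{n−1} such that (C*R) *ᵥ x = λ·((B*R) *ᵥ x). -/
open Matrix
open scoped ComplexOrder Kronecker

/-- Over an algebraically closed field, if `B` is invertible and `B ⊗ₖ F - C ⊗ₖ E` is singular,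
then some `F - γ • E` annihilates a nonzero vector for a generalized eigenvalue `γ` of `(C, B)`. -/
theorem exists_generalized_eigenvalue_of_det_kronecker_sub_eq_zero
    {K m l : Type*} [Field K] [IsAlgClosed K] [Fintype m] [DecidableEq m] [Fintype l]
    [DecidableEq l] {B C : Matrix m m K} {E F : Matrix l l K} (hB : IsUnit B.det)
    (h : (B ⊗ₖ F - C ⊗ₖ E).det = 0) :
    ∃ γ : K, (∃ v, v ≠ 0 ∧ C *ᵥ v = γ • B *ᵥ v) ∧ ∃ w, w ≠ 0 ∧ F *ᵥ w = γ • E *ᵥ w := by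
  have hBt : IsUnit Bᵀ.det := by rwa [det_transpose]
  set T : Matrix m m K := Cᵀ * Bᵀ⁻¹ with hT
  have hTB : T * Bᵀ = Cᵀ := nonsing_inv_mul_cancel_right _ _ hBt
  let g : Module.End K (Matrix l m K) := mulRightLinearMap l K T
  let p : Submodule K (Matrix l m K) :=
    LinearMap.ker (mulLeftLinearMap m K F - mulLeftLinearMap m K E ∘ₗ g)
  have mem_p (Z : Matrix l m K) : Z ∈ p ↔ F * Z = E * (Z * T) := by
    simp [p, g, sub_eq_zero]
  have hp : ∀ Z ∈ p, g Z ∈ p := by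
    intro Z hZ
    rw [mem_p] at hZ ⊢
    simp only [g, mulRightLinearMap_apply, ← Matrix.mul_assoc] at hZ ⊢
    rw [hZ]
  obtain ⟨z, hz, hz'⟩ := exists_mulVec_eq_zero_iff.mpr h
  obtain ⟨Z, rfl⟩ : ∃ Z : Matrix l m K, vec Z = z := ⟨of fun i j => z (j, i), rfl⟩
  have hZ : Z ∈ p := by
    rw [sub_mulVec, kronecker_mulVec_vec, kronecker_mulVec_vec, sub_eq_zero, vec_inj] at hz'
    rw [mem_p, hT, ← Matrix.mul_assoc, ← Matrix.mul_assoc, ← hz',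
      mul_nonsing_inv_cancel_right _ _ hBt]
  have : Nontrivial p := ⟨⟨Z, hZ⟩, 0, fun h0 => hz (by simpa using congrArg Subtype.val h0)⟩
  obtain ⟨γ, hγ⟩ := Module.End.exists_eigenvalue (g.restrict hp)
  obtain ⟨⟨Y, hY⟩, hYγ⟩ := hγ.exists_hasEigenvector
  have hY0 : Y ≠ 0 := fun h0 => hYγ.2 (Subtype.ext h0)
  have hYT : Y * T = γ • Y := congrArg Subtype.val hYγ.apply_eq_smul
  rw [mem_p, hYT, Matrix.mul_smul] at hY
  have hYC : Y * Cᵀ = γ • (Y * Bᵀ) := by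
    rw [← hTB, ← Matrix.mul_assoc, hYT, smul_mul]
  obtain ⟨i, j, hij⟩ : ∃ i j, Y i j ≠ 0 := by
    by_contra! h0
    exact hY0 (Matrix.ext h0)
  refine ⟨γ, ⟨Y i, fun h0 => hij (congrFun h0 j), ?_⟩, Y.col j, fun h0 => hij (congrFun h0 i), ?_⟩
  · ext k
    simpa [mul_apply, mulVec, dotProduct, mul_comm] using congrFun (congrFun hYC i) k
  · ext k
    simpa [mul_apply, mulVec, dotProduct] using congrFun (congrFun hY k) j

/-- Generalized eigenvalues of a Hermitian matrix with respect to a positive definite one are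
real. -/
theorem star_eq_self_of_mulVec_eq_smul_mulVec {m : Type*} [Fintype m]
    {B C : Matrix m m ℂ} (hC : C.IsHermitian) (hB : B.PosDef) {γ : ℂ} {v : m → ℂ} (hv : v ≠ 0)
    (h : C *ᵥ v = γ • B *ᵥ v) : star γ = γ := by
  have hpos := hB.dotProduct_mulVec_pos hv
  have key (M : Matrix m m ℂ) (hM : M.IsHermitian) :
      star (star v ⬝ᵥ M *ᵥ v) = star v ⬝ᵥ M *ᵥ v := by
    rw [← star_dotProduct_star, star_mulVec, hM.eq, star_star, dotProduct_mulVec]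
  have hCv := key C hC
  rw [h, dotProduct_smul, smul_eq_mul, star_mul', key B hB.isHermitian] at hCv
  exact mul_right_cancel₀ hpos.ne' hCv

/-- For positive definite `Q`, the kernel of the saddle point matrix `[0, Kᴴ; K, Q]` is
`ker K × 0`. -/
theorem mulVec_eq_zero_of_saddle_point {l m : Type*} [Fintype l] [Fintype m]
    {K : Matrix m l ℂ} {Q : Matrix m m ℂ} (hQ : Q.PosDef) {x : l → ℂ} {y : m → ℂ}
    (h₁ : Kᴴ *ᵥ y = 0) (h₂ : K *ᵥ x + Q *ᵥ y = 0) : y = 0 ∧ K *ᵥ x = 0 := by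
  have hy : y = 0 := by
    by_contra hy
    have hpos := hQ.dotProduct_mulVec_pos hy
    have hKx : star y ⬝ᵥ K *ᵥ x = 0 := by
      have := congrArg star h₁
      rw [star_mulVec, conjTranspose_conjTranspose, star_zero] at this
      rw [dotProduct_mulVec, this, zero_dotProduct]
    have := congrArg (star y ⬝ᵥ ·) h₂
    simp only [dotProduct_add, hKx, zero_add, dotProduct_zero] at this
    exact hpos.ne' this
  subst hy
  simpa using h₂

theorem stmt_10 (n : ℕ) (hn : 0 < n)
    (A B C P Q : Matrix (Fin n) (Fin n) ℂ)
    (hA : A.IsHermitian) (hC : C.IsHermitian) (hP : P.IsHermitian)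
    (hB : B.PosDef) (hQ : Q.PosDef)
    (R : Matrix (Fin n) (Fin (n - 1)) ℂ) (hR : Function.Injective R.mulVec)
    (Bhat : Matrix (Fin (n - 1) ⊕ Fin n) (Fin (n - 1) ⊕ Fin n) ℂ)
    (hBhat : Bhat = Matrix.fromBlocks 0 (Rᴴ * B) (B * R) 0)
    (Chat : Matrix (Fin (n - 1) ⊕ Fin n) (Fin (n - 1) ⊕ Fin n) ℂ)
    (hChat : Chat = Matrix.fromBlocks 0 (Rᴴ * C) (C * R) Q)
    (Δ₀ : Matrix (Fin n × (Fin (n - 1) ⊕ Fin n)) (Fin n × (Fin (n - 1) ⊕ Fin n)) ℂ)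
    (hΔ₀ : Δ₀ = B ⊗ₖ Chat - C ⊗ₖ Bhat) :
    Δ₀.det = 0 ↔ ∃ (lam : ℂ) (x : Fin (n - 1) → ℂ), x ≠ 0 ∧
      (C * R).mulVec x = lam • (B * R).mulVec x := by
  subst hΔ₀ hBhat hChat
  constructor
  · intro h
    obtain ⟨γ, ⟨v, hv, hCv⟩, w, hw, hFw⟩ :=
      exists_generalized_eigenvalue_of_det_kronecker_sub_eq_zero hB.det_pos.ne'.isUnit h
    have hγ := star_eq_self_of_mulVec_eq_smul_mulVec hC hB hv hCv
    obtain ⟨x, y, rfl⟩ : ∃ x y, w = Sum.elim x y := ⟨_, _, (Sum.elim_comp_inl_inr w).symm⟩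
    rw [fromBlocks_mulVec, fromBlocks_mulVec] at hFw
    have h₁ : ((C * R - γ • (B * R))ᴴ) *ᵥ y = 0 := by
      rw [conjTranspose_sub, conjTranspose_smul, hγ, conjTranspose_mul, conjTranspose_mul, hC.eq,
        hB.isHermitian.eq, sub_mulVec, smul_mulVec, sub_eq_zero]
      ext i
      simpa using congrFun hFw (Sum.inl i)
    have h₂ : (C * R - γ • (B * R)) *ᵥ x + Q *ᵥ y = 0 := by
      rw [sub_mulVec, smul_mulVec, sub_add_eq_add_sub, sub_eq_zero]
      ext i
      simpa using congrFun hFw (Sum.inr i)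
    obtain ⟨rfl, hx⟩ := mulVec_eq_zero_of_saddle_point hQ h₁ h₂
    refine ⟨γ, x, ?_, ?_⟩
    · rintro rfl
      exact hw (by ext (i | i) <;> rfl)
    · rwa [sub_mulVec, smul_mulVec, sub_eq_zero] at hx
  · rintro ⟨γ, x, hx, h⟩
    have hu : R *ᵥ x ≠ 0 := fun h0 => hx (hR (by rw [h0, mulVec_zero]))
    have hw : Sum.elim x (0 : Fin n → ℂ) ≠ 0 := fun h0 =>
      hx (funext fun i => congrFun h0 (Sum.inl i))
    have hF : fromBlocks 0 (Rᴴ * C) (C * R) Q *ᵥ Sum.elim x 0 =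
        γ • fromBlocks 0 (Rᴴ * B) (B * R) 0 *ᵥ Sum.elim x 0 := by
      rw [fromBlocks_mulVec, fromBlocks_mulVec]
      ext (i | i)
      · simp
      · simpa using congrFun h i
    rw [← exists_mulVec_eq_zero_iff]
    refine ⟨vec (vecMulVec (Sum.elim x 0) (R *ᵥ x)), ?_, ?_⟩
    · rw [Ne, vec_eq_zero_iff]
      obtain ⟨i, hi⟩ := Function.ne_iff.mp hw
      obtain ⟨j, hj⟩ := Function.ne_iff.mp hu
      exact fun h0 => mul_ne_zero hi hj (congrFun (congrFun h0 i) j)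
    · rw [← mulVec_mulVec, ← mulVec_mulVec] at h
      rw [sub_mulVec, kronecker_mulVec_vec, kronecker_mulVec_vec, sub_eq_zero, mul_vecMulVec,
        mul_vecMulVec, vecMulVec_mul, vecMulVec_mul, vecMul_transpose, vecMul_transpose, hF, h,
        smul_vecMulVec, vecMulVec_smul]
end

section
/- If (λ, μ) ∈ ℂ × ℂ satisfies det(M(λ,μ)) = 0 and trace(S(μ) * adjugate(M(λ,μ))) = 0, then there exist a nonzero vector v ∈ ℂⁿ and a nonzero vector w ∈ ℂ^{n−1} ⊕ ℂⁿ such that M(λ,μ) *ᵥ v = 0 and (Â − λ·B̂ − μ·Ĉ) *ᵥ w = 0, i.e. (λ, μ, v, w) solves the MEP. -/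
open Matrix
open scoped ComplexOrder

/-- If column `k` of `M * T` vanishes, then replacing it by column `k` of `S * T` yields a matrix
with determinant `det T * tr (S * adj M)`. -/
theorem Matrix.det_updateCol_mul_eq_det_mul_trace_adjugate {ι K : Type*} [Fintype ι]
    [DecidableEq ι] [CommRing K] (M S T : Matrix ι ι K) (k : ι)
    (hk : ∀ i, (M * T) i k = 0) :
    ((M * T).updateCol k ((S * T).col k)).det = T.det * (S * M.adjugate).trace := by
  have hadj : ∀ j, j ≠ k → ∀ i, (M * T).adjugate j i = 0 := by
    intro j hj i
    rw [adjugate_apply]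
    refine det_eq_zero_of_column_eq_zero k fun l => ?_
    by_cases hl : l = i
    · subst hl
      simp [hj.symm]
    · simp [updateRow_ne hl, hk]
  have htr : T.det * (S * M.adjugate).trace = (S * T * (M * T).adjugate).trace := by
    rw [adjugate_mul_distrib, Matrix.mul_assoc, ← Matrix.mul_assoc T, mul_adjugate]
    simp
  rw [htr, ← cramer_apply, cramer_eq_adjugate_mulVec, mulVec, dotProduct, trace]
  refine Finset.sum_congr rfl fun i _ => ?_
  rw [diag_apply, mul_apply, Finset.sum_eq_single k (fun j _ hj => by rw [hadj j hj, mul_zero])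
    (by simp), mul_comm, col_apply]

/-- If `det M = 0` and `tr (S * adj M) = 0`, then both `M` and every bordered matrix with blocks
`0`, `L * M`, `M * R`, `S` are singular, where `R` has one column fewer than `M`. -/
theorem Matrix.exists_mulVec_fromBlocks_eq_zero_of_trace_mul_adjugate_eq_zero {K : Type*} [Field K]
    {m : ℕ} (M S : Matrix (Fin (m + 1)) (Fin (m + 1)) K) (L : Matrix (Fin m) (Fin (m + 1)) K)
    (R : Matrix (Fin (m + 1)) (Fin m) K) (hdet : M.det = 0)
    (htr : (S * M.adjugate).trace = 0) :
    ∃ (v : Fin (m + 1) → K) (w : Fin m ⊕ Fin (m + 1) → K), v ≠ 0 ∧ w ≠ 0 ∧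
      M *ᵥ v = 0 ∧ fromBlocks 0 (L * M) (M * R) S *ᵥ w = 0 := by
  obtain ⟨v, hv, hMv⟩ := exists_mulVec_eq_zero_iff.mpr hdet
  set T : Matrix (Fin (m + 1)) (Fin (m + 1)) K :=
    of fun i => Fin.snoc (α := fun _ => K) (R i) (v i) with hT
  have hlast : ∀ N : Matrix (Fin (m + 1)) (Fin (m + 1)) K, ∀ i,
      (N * T) i (Fin.last m) = (N *ᵥ v) i := fun N i => by
    simp [mul_apply, mulVec, dotProduct, hT]
  have hcast : ∀ i j, (M * T) i (Fin.castSucc j) = (M * R) i j := fun i j => by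
    simp [mul_apply, hT]
  have hG := det_updateCol_mul_eq_det_mul_trace_adjugate M S T (Fin.last m)
    (fun i => by rw [hlast, hMv, Pi.zero_apply])
  rw [htr, mul_zero] at hG
  obtain ⟨y, hy, hGy⟩ := exists_mulVec_eq_zero_iff.mpr hG
  refine ⟨v, Sum.elim (y ∘ Fin.castSucc) (y (Fin.last m) • v), hv, fun hw => hy ?_, hMv, ?_⟩
  · funext j
    refine Fin.lastCases ?_ (fun j => congrFun hw (Sum.inl j)) j
    obtain ⟨i, hi⟩ := Function.ne_iff.mp hv
    exact (mul_eq_zero.mp (congrFun hw (Sum.inr i))).resolve_right hi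
  · have hbot : (M * R) *ᵥ (y ∘ Fin.castSucc) + S *ᵥ (y (Fin.last m) • v) = 0 := by
      funext i
      have hi := congrFun hGy i
      simp only [mulVec, dotProduct, Fin.sum_univ_castSucc, updateCol_self, col_apply, hlast,
        updateCol_ne (Fin.castSucc_lt_last _).ne, hcast] at hi
      rw [mulVec_smul, Pi.add_apply, Pi.smul_apply, smul_eq_mul, mul_comm (y _)]
      simpa only [mulVec, dotProduct, Fin.sum_univ_castSucc, Function.comp_apply] using hi
    rw [fromBlocks_mulVec]
    simp only [Sum.elim_comp_inl, Sum.elim_comp_inr]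
    rw [hbot, mulVec_smul, ← mulVec_mulVec, hMv]
    simp

theorem stmt_12 (n : ℕ) (hn : 0 < n)
    (A B C P Q : Matrix (Fin n) (Fin n) ℂ)
    (hA : A.IsHermitian) (hC : C.IsHermitian) (hP : P.IsHermitian)
    (hB : B.PosDef) (hQ : Q.PosDef)
    (R : Matrix (Fin n) (Fin (n - 1)) ℂ) (hR : Function.Injective R.mulVec)
    (Ahat : Matrix (Fin (n - 1) ⊕ Fin n) (Fin (n - 1) ⊕ Fin n) ℂ)
    (hAhat : Ahat = Matrix.fromBlocks 0 (Rᴴ * A) (A * R) P)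
    (Bhat : Matrix (Fin (n - 1) ⊕ Fin n) (Fin (n - 1) ⊕ Fin n) ℂ)
    (hBhat : Bhat = Matrix.fromBlocks 0 (Rᴴ * B) (B * R) 0)
    (Chat : Matrix (Fin (n - 1) ⊕ Fin n) (Fin (n - 1) ⊕ Fin n) ℂ)
    (hChat : Chat = Matrix.fromBlocks 0 (Rᴴ * C) (C * R) Q)
    (lam μ : ℂ)
    (hdet : (A - lam • B - μ • C).det = 0)
    (htr : ((P - μ • Q) * (A - lam • B - μ • C).adjugate).trace = 0) :
    ∃ (v : Fin n → ℂ) (w : Fin (n - 1) ⊕ Fin n → ℂ), v ≠ 0 ∧ w ≠ 0 ∧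
      (A - lam • B - μ • C).mulVec v = 0 ∧
      (Ahat - lam • Bhat - μ • Chat).mulVec w = 0 := by
  obtain ⟨m, rfl⟩ : ∃ m, n = m + 1 := ⟨n - 1, by omega⟩
  obtain ⟨v, w, hv, hw, hMv, hKw⟩ :=
    exists_mulVec_fromBlocks_eq_zero_of_trace_mul_adjugate_eq_zero
      (A - lam • B - μ • C) (P - μ • Q) Rᴴ R hdet htr
  refine ⟨v, w, hv, hw, hMv, ?_⟩
  have hblocks : Ahat - lam • Bhat - μ • Chat =
      fromBlocks 0 (Rᴴ * (A - lam • B - μ • C)) ((A - lam • B - μ • C) * R) (P - μ • Q) := by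
    rw [hAhat, hBhat, hChat]
    simp [fromBlocks_smul, sub_eq_add_neg, fromBlocks_neg, fromBlocks_add, Matrix.mul_add,
      Matrix.add_mul]
  rw [hblocks]
  exact hKw
end

section
/- Let σ ∈ ℂ, set Γ = A − σ·B and Γ̂ = Â − σ·B̂. Assume that for every skew-symmetric n×n complex matrix X (Xᵀ = −X), the equation Rᴴ * (C*X*Γᵀ − Γ*X*Cᵀ) * conj(R) = 0 implies X = 0 (conj(R) is the entrywise complex conjugate of R). Let Z and Z' be (2n−1)×n complex matrices (rows indexed by Fin(n−1) ⊕ Fin n) satisfying the Sylvester equation Ĉ * Z' * Γᵀ − Γ̂ * Z' * Cᵀ = Ĉ * Z * Bᵀ − B̂ * Z * Cᵀ, and suppose the bottom n×n block V of Z (rows in the Fin n summand) is symmetric (Vᵀ = V). Then the bottom n×n block V' of Z' is also symmetric. -/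
open Matrix
open scoped ComplexOrder

/-- The top block row of the product of a block matrix with vanishing upper left block. -/
lemma Matrix.submatrix_inl_fromBlocks_zero_mul {l m n p α : Type*} [Fintype l] [Fintype m]
    [NonUnitalNonAssocSemiring α]
    (B : Matrix p m α) (C : Matrix n l α) (D : Matrix n m α) (Z : Matrix (l ⊕ m) n α) :
    (fromBlocks 0 B C D * Z).submatrix Sum.inl id = B * Z.submatrix Sum.inr id := by
  ext i j
  simp [mul_apply]

/-- The compression by `R` of `X ↦ C * X * Gᵀ - G * X * Cᵀ` anticommutes with transposition. -/
lemma Matrix.transpose_conj_compression {m n : Type*} [Fintype n]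
    (R : Matrix n m ℂ) (C G X : Matrix n n ℂ) :
    (Rᴴ * (C * X * Gᵀ - G * X * Cᵀ) * R.map (starRingEnd ℂ))ᵀ =
      -(Rᴴ * (C * Xᵀ * Gᵀ - G * Xᵀ * Cᵀ) * R.map (starRingEnd ℂ)) := by
  have h : (Rᴴ)ᵀ = R.map (starRingEnd ℂ) := rfl
  have h' : (R.map (starRingEnd ℂ))ᵀ = Rᴴ := rfl
  simp only [transpose_mul, transpose_sub, transpose_transpose, h, h']
  rw [← neg_sub (G * Xᵀ * Cᵀ), Matrix.mul_neg, Matrix.neg_mul, neg_neg]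
  simp only [Matrix.mul_assoc]

theorem stmt_13 (n : ℕ) (hn : 0 < n)
    (A B C P Q : Matrix (Fin n) (Fin n) ℂ)
    (hA : A.IsHermitian) (hC : C.IsHermitian) (hP : P.IsHermitian)
    (hB : B.PosDef) (hQ : Q.PosDef)
    (R : Matrix (Fin n) (Fin (n - 1)) ℂ) (hR : Function.Injective R.mulVec)
    (Ahat : Matrix (Fin (n - 1) ⊕ Fin n) (Fin (n - 1) ⊕ Fin n) ℂ)
    (hAhat : Ahat = Matrix.fromBlocks 0 (Rᴴ * A) (A * R) P)
    (Bhat : Matrix (Fin (n - 1) ⊕ Fin n) (Fin (n - 1) ⊕ Fin n) ℂ)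
    (hBhat : Bhat = Matrix.fromBlocks 0 (Rᴴ * B) (B * R) 0)
    (Chat : Matrix (Fin (n - 1) ⊕ Fin n) (Fin (n - 1) ⊕ Fin n) ℂ)
    (hChat : Chat = Matrix.fromBlocks 0 (Rᴴ * C) (C * R) Q)
    (σ : ℂ)
    (hskew : ∀ X : Matrix (Fin n) (Fin n) ℂ, Xᵀ = -X →
      Rᴴ * (C * X * (A - σ • B)ᵀ - (A - σ • B) * X * Cᵀ) * (R.map (starRingEnd ℂ)) = 0 →
      X = 0)
    (Z Z' : Matrix (Fin (n - 1) ⊕ Fin n) (Fin n) ℂ)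
    (hsyl : Chat * Z' * (A - σ • B)ᵀ - (Ahat - σ • Bhat) * Z' * Cᵀ =
      Chat * Z * Bᵀ - Bhat * Z * Cᵀ)
    (hV : (Z.submatrix Sum.inr id)ᵀ = Z.submatrix Sum.inr id) :
    (Z'.submatrix Sum.inr id)ᵀ = Z'.submatrix Sum.inr id := by
  subst hAhat hBhat hChat
  set G := A - σ • B with hG
  set V := Z.submatrix Sum.inr id
  set V' := Z'.submatrix Sum.inr id
  have hpencil : fromBlocks 0 (Rᴴ * A) (A * R) P - σ • fromBlocks 0 (Rᴴ * B) (B * R) 0 =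
      fromBlocks 0 (Rᴴ * G) (G * R) P := by
    simp [hG, sub_eq_add_neg, fromBlocks_smul, fromBlocks_neg, fromBlocks_add, Matrix.mul_add,
      Matrix.add_mul]
  rw [hpencil] at hsyl
  have htop : Rᴴ * (C * V' * Gᵀ - G * V' * Cᵀ) = Rᴴ * (C * V * Bᵀ - B * V * Cᵀ) := by
    have h := congrArg (fun M => M.submatrix Sum.inl id) hsyl
    have hmul (M : Matrix (Fin (n - 1) ⊕ Fin n) (Fin n) ℂ) (N : Matrix (Fin n) (Fin n) ℂ) :
        (M * N).submatrix Sum.inl id = M.submatrix Sum.inl id * N := rfl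
    simp only [submatrix_sub, Pi.sub_apply, hmul, submatrix_inl_fromBlocks_zero_mul] at h
    simpa only [Matrix.mul_sub, Matrix.mul_assoc] using h
  have hcomp := congrArg (· * R.map (starRingEnd ℂ)) htop
  have hcompT := congrArg transpose hcomp
  simp only [transpose_conj_compression, hV, neg_inj] at hcompT
  have hzero : V' - V'ᵀ = 0 := by
    refine hskew _ (by simp) ?_
    have h := sub_eq_zero.mpr (hcomp.trans hcompT.symm)
    rw [← h]
    simp only [Matrix.mul_sub, Matrix.sub_mul]
    abel
  exact (sub_eq_zero.mp hzero).symm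
end

section
/- Let W₀ be an (n−1)×n complex matrix such that R*W₀ is symmetric ((R*W₀)ᵀ = R*W₀), and let z = vec(Z₀) where Z₀ is the (2n−1)×n matrix with top block W₀ and bottom block 0. Let W₁ be any (n−1)×n complex matrix and V a symmetric n×n complex matrix (Vᵀ = V), and let z' = vec(Z₁) where Z₁ has top block W₁ and bottom block V. Then for every λ ∈ ℂ, (star z') ⬝ᵥ ((Δ₁ − λ·Δ₀) *ᵥ z) = 0. -/
open Matrix
open scoped ComplexOrder Kronecker

theorem star_vec_fromRows_dotProduct_kronecker_fromBlocks_mulVec {m n : Type*} [Fintype m] [Fintype n]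
    (X Y G V : Matrix n n ℂ) (F : Matrix m n ℂ) (R : Matrix n m ℂ) (W₀ W₁ : Matrix m n ℂ) :
    star (vec (fromRows W₁ V)) ⬝ᵥ
        (X ⊗ₖ fromBlocks 0 F (Y * R) G) *ᵥ vec (fromRows W₀ (0 : Matrix n n ℂ)) =
      (Vᴴ * (Y * (R * W₀) * Xᵀ)).trace := by
  rw [kronecker_mulVec_vec, star_vec_dotProduct_vec, fromBlocks_mul_fromRows, fromRows_mul,
    conjTranspose_fromRows_eq_fromCols_conjTranspose, fromCols_mul_fromRows]
  simp [Matrix.mul_assoc]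

theorem trace_conjTranspose_mul_comm_of_symm {n : Type*} [Fintype n]
    (X Y S V : Matrix n n ℂ) (hS : Sᵀ = S) (hV : Vᵀ = V) :
    (Vᴴ * (Y * S * Xᵀ)).trace = (Vᴴ * (X * S * Yᵀ)).trace := by
  have hVt : Vᴴᵀ = Vᴴ := by
    rw [conjTranspose, hV, ← transpose_map, hV]
  rw [← trace_transpose, transpose_mul, trace_mul_comm, hVt]
  simp [transpose_mul, hS, Matrix.mul_assoc]

theorem stmt_14 (n : ℕ) (hn : 0 < n)
    (A B C P Q : Matrix (Fin n) (Fin n) ℂ)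
    (hA : A.IsHermitian) (hC : C.IsHermitian) (hP : P.IsHermitian)
    (hB : B.PosDef) (hQ : Q.PosDef)
    (R : Matrix (Fin n) (Fin (n - 1)) ℂ) (hR : Function.Injective R.mulVec)
    (Ahat : Matrix (Fin (n - 1) ⊕ Fin n) (Fin (n - 1) ⊕ Fin n) ℂ)
    (hAhat : Ahat = Matrix.fromBlocks 0 (Rᴴ * A) (A * R) P)
    (Bhat : Matrix (Fin (n - 1) ⊕ Fin n) (Fin (n - 1) ⊕ Fin n) ℂ)
    (hBhat : Bhat = Matrix.fromBlocks 0 (Rᴴ * B) (B * R) 0)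
    (Chat : Matrix (Fin (n - 1) ⊕ Fin n) (Fin (n - 1) ⊕ Fin n) ℂ)
    (hChat : Chat = Matrix.fromBlocks 0 (Rᴴ * C) (C * R) Q)
    (Δ₀ Δ₁ : Matrix (Fin n × (Fin (n - 1) ⊕ Fin n)) (Fin n × (Fin (n - 1) ⊕ Fin n)) ℂ)
    (hΔ₀ : Δ₀ = B ⊗ₖ Chat - C ⊗ₖ Bhat)
    (hΔ₁ : Δ₁ = A ⊗ₖ Chat - C ⊗ₖ Ahat)
    (W₀ : Matrix (Fin (n - 1)) (Fin n) ℂ) (hW₀ : (R * W₀)ᵀ = R * W₀)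
    (W₁ : Matrix (Fin (n - 1)) (Fin n) ℂ)
    (V : Matrix (Fin n) (Fin n) ℂ) (hV : Vᵀ = V)
    (z z' : Fin n × (Fin (n - 1) ⊕ Fin n) → ℂ)
    (hz : z = fun p => Sum.elim (fun i => W₀ i p.1) (fun _ => (0 : ℂ)) p.2)
    (hz' : z' = fun p => Sum.elim (fun i => W₁ i p.1) (fun i => V i p.1) p.2)
    (lam : ℂ) :
    star z' ⬝ᵥ (Δ₁ - lam • Δ₀).mulVec z = 0 := by
  have hz₀ : z = vec (fromRows W₀ (0 : Matrix (Fin n) (Fin n) ℂ)) := by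
    rw [hz]; ext ⟨j, i | i⟩ <;> rfl
  have hz₁ : z' = vec (fromRows W₁ V) := by
    rw [hz']; ext ⟨j, i | i⟩ <;> rfl
  rw [hΔ₀, hΔ₁, hAhat, hBhat, hChat, hz₀, hz₁]
  simp only [sub_mulVec, smul_mulVec, dotProduct_sub, dotProduct_smul,
    star_vec_fromRows_dotProduct_kronecker_fromBlocks_mulVec]
  rw [trace_conjTranspose_mul_comm_of_symm A C _ V hW₀ hV,
    trace_conjTranspose_mul_comm_of_symm B C _ V hW₀ hV]
  simp
end

section
/- Let k > n² and let Z be a complex matrix with rows indexed by Fin n × (Fin(n−1) ⊕ Fin n) and columns indexed by Fin k, each of whose columns lies in 𝒵 (i.e. each column equals vec of a (2n−1)×n block matrix whose bottom n×n block is symmetric). Set H₁ = Zᴴ * Δ₁ * Z and H₀ = Zᴴ * Δ₀ * Z, both k×k matrices. Then there exists a nonzero y ∈ ℂᵏ such that (H₁ − λ·H₀) *ᵥ y = 0 for every λ ∈ ℂ; in particular the pencil (H₁, H₀) is singular, i.e. det(H₁ − λ·H₀) = 0 for all λ ∈ ℂ. -/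
open Matrix
open scoped ComplexOrder Kronecker

/-- The operator determinant of the pairs `(A, Ahat)` and `(C, Chat)` maps `vec [W; 0]` to the
vectorization of a matrix supported on its bottom block. -/
theorem operatorDet_mulVec_vec {m r : Type*} [Fintype m] [Fintype r]
    (A C P Q : Matrix m m ℂ) (R : Matrix m r ℂ) (W : Matrix r m ℂ) :
    (A ⊗ₖ fromBlocks 0 (Rᴴ * C) (C * R) Q - C ⊗ₖ fromBlocks 0 (Rᴴ * A) (A * R) P) *ᵥ
        vec (fromRows W 0) =
      vec (fromRows 0 (C * (R * W) * Aᵀ - A * (R * W) * Cᵀ)) := by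
  rw [sub_mulVec, kronecker_mulVec_vec, kronecker_mulVec_vec, ← vec_sub, fromBlocks_mul_fromRows,
    fromBlocks_mul_fromRows]
  simp only [fromRows_mul, Matrix.zero_mul, Matrix.mul_zero, add_zero, Matrix.mul_assoc]
  congr 1
  ext (i | i) j <;> simp

theorem sum_sum_mul_eq_zero_of_symm_of_skew {m : Type*} [Fintype m] {V G : Matrix m m ℂ}
    (hV : Vᵀ = V) (hG : Gᵀ = -G) : ∑ j, ∑ i, V i j * G i j = 0 := by
  have h : ∑ j, ∑ i, V i j * G i j = -∑ j, ∑ i, V i j * G i j := by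
    conv_lhs => rw [Finset.sum_comm]
    simp only [← Finset.sum_neg_distrib]
    refine Finset.sum_congr rfl fun j _ => Finset.sum_congr rfl fun i _ => ?_
    have h₁ : V j i = V i j := congr_fun₂ hV i j
    have h₂ : G j i = -G i j := congr_fun₂ hG i j
    rw [h₁, h₂, mul_neg]
  exact self_eq_neg.mp h

/-- The compression of an operator determinant to matrices with symmetric bottom block annihilates
every `y` for which `Z *ᵥ y` is `vec [W; 0]` with `R * W` symmetric. -/
theorem compression_operatorDet_mulVec_eq_zero {m r l : Type*} [Fintype m] [Fintype r] [Fintype l]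
    (A C P Q : Matrix m m ℂ) (R : Matrix m r ℂ) (W : Matrix r m ℂ) (hW : (R * W)ᵀ = R * W)
    (Z : Matrix (m × (r ⊕ m)) l ℂ) (hZ : ∀ c i j, Z (i, Sum.inr j) c = Z (j, Sum.inr i) c)
    (y : l → ℂ) (hy : Z *ᵥ y = vec (fromRows W 0)) :
    (Zᴴ * (A ⊗ₖ fromBlocks 0 (Rᴴ * C) (C * R) Q - C ⊗ₖ fromBlocks 0 (Rᴴ * A) (A * R) P) * Z) *ᵥ y
      = 0 := by
  rw [← mulVec_mulVec, hy, ← mulVec_mulVec, operatorDet_mulVec_vec]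
  ext c
  have hG : (C * (R * W) * Aᵀ - A * (R * W) * Cᵀ)ᵀ = -(C * (R * W) * Aᵀ - A * (R * W) * Cᵀ) := by
    simp only [transpose_sub, transpose_mul, transpose_transpose, neg_sub]
    rw [← transpose_mul, hW]
    simp only [Matrix.mul_assoc]
  have hV : (of fun i j => star (Z (j, Sum.inr i) c) : Matrix m m ℂ)ᵀ =
      of fun i j => star (Z (j, Sum.inr i) c) := by
    ext i j
    exact congr_arg star (hZ c i j)
  simpa [mulVec, dotProduct, Fintype.sum_prod_type, vec] using
    sum_sum_mul_eq_zero_of_symm_of_skew hV hG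

/-- There is a nonzero vector at which the symmetric part `V` and the skew part of `S` both vanish,
as together these have only `n ^ 2` independent entries. -/
theorem exists_ne_zero_symm_skew_eq_zero {n k : ℕ} (hk : n ^ 2 < k)
    (V S : (Fin k → ℂ) →ₗ[ℂ] Matrix (Fin n) (Fin n) ℂ) (hV : ∀ y, (V y)ᵀ = V y) :
    ∃ y, y ≠ 0 ∧ V y = 0 ∧ (S y)ᵀ = S y := by
  let L : (Fin k → ℂ) →ₗ[ℂ] Matrix (Fin n) (Fin n) ℂ :=
    { toFun := fun y => of fun i j => if i ≤ j then V y i j else S y i j - S y j i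
      map_add' := fun x y => by
        ext i j
        simp only [map_add, of_apply, Matrix.add_apply]
        split_ifs <;> ring
      map_smul' := fun a y => by
        ext i j
        simp only [map_smul, of_apply, Matrix.smul_apply, smul_eq_mul, RingHom.id_apply]
        split_ifs <;> ring }
  have hrank : Module.finrank ℂ (Matrix (Fin n) (Fin n) ℂ) < Module.finrank ℂ (Fin k → ℂ) := by
    simpa [Module.finrank_matrix, ← sq] using hk
  obtain ⟨y, hy, hy0⟩ :=
    (Submodule.ne_bot_iff _).mp (LinearMap.ker_ne_bot_of_finrank_lt (f := L) hrank)
  have hL : ∀ i j, (if i ≤ j then V y i j else S y i j - S y j i) = 0 := fun i j =>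
    congr_fun₂ (show L y = 0 from hy) i j
  have hlow : ∀ i j, j < i → S y i j = S y j i := fun i j hij => by
    simpa [not_le.mpr hij, sub_eq_zero] using hL i j
  refine ⟨y, hy0, ?_, ?_⟩
  · ext i j
    rcases le_total i j with h | h
    · simpa [h] using hL i j
    · rw [← hV y]
      simpa [h] using hL j i
  · ext i j
    rcases lt_trichotomy i j with h | rfl | h
    · exact hlow j i h
    · rfl
    · exact (hlow i j h).symm

theorem stmt_15 (n : ℕ) (hn : 0 < n)
    (A B C P Q : Matrix (Fin n) (Fin n) ℂ)
    (hA : A.IsHermitian) (hC : C.IsHermitian) (hP : P.IsHermitian)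
    (hB : B.PosDef) (hQ : Q.PosDef)
    (R : Matrix (Fin n) (Fin (n - 1)) ℂ) (hR : Function.Injective R.mulVec)
    (Ahat : Matrix (Fin (n - 1) ⊕ Fin n) (Fin (n - 1) ⊕ Fin n) ℂ)
    (hAhat : Ahat = Matrix.fromBlocks 0 (Rᴴ * A) (A * R) P)
    (Bhat : Matrix (Fin (n - 1) ⊕ Fin n) (Fin (n - 1) ⊕ Fin n) ℂ)
    (hBhat : Bhat = Matrix.fromBlocks 0 (Rᴴ * B) (B * R) 0)
    (Chat : Matrix (Fin (n - 1) ⊕ Fin n) (Fin (n - 1) ⊕ Fin n) ℂ)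
    (hChat : Chat = Matrix.fromBlocks 0 (Rᴴ * C) (C * R) Q)
    (Δ₀ Δ₁ : Matrix (Fin n × (Fin (n - 1) ⊕ Fin n)) (Fin n × (Fin (n - 1) ⊕ Fin n)) ℂ)
    (hΔ₀ : Δ₀ = B ⊗ₖ Chat - C ⊗ₖ Bhat)
    (hΔ₁ : Δ₁ = A ⊗ₖ Chat - C ⊗ₖ Ahat)
    (k : ℕ) (hk : n ^ 2 < k)
    (Z : Matrix (Fin n × (Fin (n - 1) ⊕ Fin n)) (Fin k) ℂ)
    (hZ : ∀ c : Fin k, ∃ (W : Matrix (Fin (n - 1)) (Fin n) ℂ)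
      (V : Matrix (Fin n) (Fin n) ℂ), Vᵀ = V ∧
      ∀ p : Fin n × (Fin (n - 1) ⊕ Fin n),
        Z p c = Sum.elim (fun i => W i p.1) (fun i => V i p.1) p.2) :
    ∃ y : Fin k → ℂ, y ≠ 0 ∧
      (∀ lam : ℂ, ((Zᴴ * Δ₁ * Z) - lam • (Zᴴ * Δ₀ * Z)).mulVec y = 0) ∧
      (∀ lam : ℂ, ((Zᴴ * Δ₁ * Z) - lam • (Zᴴ * Δ₀ * Z)).det = 0) := by
  have hZsymm : ∀ c i j, Z (i, Sum.inr j) c = Z (j, Sum.inr i) c := fun c i j => by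
    obtain ⟨W, V, hV, hp⟩ := hZ c
    rw [hp, hp]
    exact congr_fun₂ hV i j
  let W : (Fin k → ℂ) →ₗ[ℂ] Matrix (Fin (n - 1)) (Fin n) ℂ :=
    { toFun := fun y => of fun i j => (Z *ᵥ y) (j, Sum.inl i)
      map_add' := fun x y => by ext i j; simp [mulVec_add]
      map_smul' := fun a y => by ext i j; simp [mulVec_smul] }
  let V : (Fin k → ℂ) →ₗ[ℂ] Matrix (Fin n) (Fin n) ℂ :=
    { toFun := fun y => of fun i j => (Z *ᵥ y) (j, Sum.inr i)
      map_add' := fun x y => by ext i j; simp [mulVec_add]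
      map_smul' := fun a y => by ext i j; simp [mulVec_smul] }
  have hV : ∀ y, (V y)ᵀ = V y := fun y => by
    ext i j
    change ∑ c, Z (i, Sum.inr j) c * y c = ∑ c, Z (j, Sum.inr i) c * y c
    simp only [hZsymm _ i j]
  obtain ⟨y, hy0, hVy, hSy⟩ :=
    exists_ne_zero_symm_skew_eq_zero hk V ((mulLeftLinearMap (Fin n) ℂ R) ∘ₗ W) hV
  have hy : Z *ᵥ y = vec (fromRows (W y) 0) := by
    rw [← hVy]
    ext ⟨j, i | i⟩ <;> rfl
  have h₁ : (Zᴴ * Δ₁ * Z) *ᵥ y = 0 := by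
    rw [hΔ₁, hChat, hAhat]
    exact compression_operatorDet_mulVec_eq_zero A C P Q R (W y) hSy Z hZsymm y hy
  have h₀ : (Zᴴ * Δ₀ * Z) *ᵥ y = 0 := by
    rw [hΔ₀, hChat, hBhat]
    exact compression_operatorDet_mulVec_eq_zero B C 0 Q R (W y) hSy Z hZsymm y hy
  have h : ∀ lam : ℂ, ((Zᴴ * Δ₁ * Z) - lam • (Zᴴ * Δ₀ * Z)).mulVec y = 0 := fun lam => by
    rw [sub_mulVec, smul_mulVec, h₁, h₀, smul_zero, sub_zero]
  exact ⟨y, hy0, h, fun lam => exists_mulVec_eq_zero_iff.mp ⟨y, hy0, h lam⟩⟩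
end

section
/- Assume rank(C) < n − 1 and assume that no eigenvector of the pencil (C, B) corresponding to a nonzero eigenvalue lies in the column space of R: for every θ ∈ ℂ with θ ≠ 0 and every nonzero v ∈ ℂⁿ with C *ᵥ v = θ·(B *ᵥ v), there is no x ∈ ℂ^{n−1} with v = R *ᵥ x. Then every vector z with Δ₀ *ᵥ z = 0 also satisfies Δ₁ *ᵥ z = 0; consequently (Δ₁ − σ·Δ₀) *ᵥ z = 0 for every σ ∈ ℂ. -/
open Matrix
open scoped ComplexOrder Kronecker
/-- An endomorphism over an algebraically closed field without nonzero eigenvalues and without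
generalized eigenvectors for the eigenvalue zero vanishes. -/
theorem Module.End.eq_zero_of_forall_not_hasEigenvalue {K V : Type*} [Field K] [IsAlgClosed K]
    [AddCommGroup V] [Module K V] [FiniteDimensional K V] (f : Module.End K V)
    (hker : ∀ x, f (f x) = 0 → f x = 0) (heig : ∀ μ, μ ≠ 0 → ¬ f.HasEigenvalue μ) : f = 0 := by
  have htop : f.maxGenEigenspace 0 = ⊤ := by
    rw [eq_top_iff, ← f.iSup_maxGenEigenspace_eq_top]
    refine iSup_le fun μ ↦ ?_
    by_cases hμ : μ = 0
    · rw [hμ]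
    · have : f.maxGenEigenspace μ = ⊥ := by
        by_contra h
        exact heig μ hμ ((hasUnifEigenvalue_iff_hasUnifEigenvalue_one (k := ⊤) (by simp)).1 h)
      rw [this]
      exact bot_le
  have hpow : ∀ (k : ℕ) (x : V), (f ^ k) x = 0 → f x = 0 := by
    intro k
    induction k with
    | zero => intro x hx; simp_all
    | succ k ih =>
      intro x hx
      rw [pow_succ, Module.End.mul_apply] at hx
      exact hker x (ih _ hx)
  ext x
  have hx : x ∈ f.maxGenEigenspace 0 := htop ▸ Submodule.mem_top
  obtain ⟨k, hk⟩ := (f.mem_maxGenEigenspace 0 x).1 hx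
  exact hpow k x (by simpa using hk)

namespace Matrix

variable {m n : Type*} [Fintype m] [Fintype n]

/-- For a Hermitian matrix `C` and a positive definite matrix `B`, a generalized eigenvector of the
pencil `(C, B)` for the eigenvalue zero lies in the kernel of `C`. -/
theorem PosDef.mulVec_eq_zero_of_mulVec_inv_mul_mulVec_eq_zero [DecidableEq n]
    {B C : Matrix n n ℂ} (hB : B.PosDef) (hC : C.IsHermitian) {w : n → ℂ}
    (h : C *ᵥ ((B⁻¹ * C) *ᵥ w) = 0) : C *ᵥ w = 0 := by
  by_contra hw
  have hpos := hB.inv.dotProduct_mulVec_pos hw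
  rw [mulVec_mulVec, star_mulVec, ← dotProduct_mulVec, hC.eq, h] at hpos
  simp at hpos

/-- If the column space of `U` contains no eigenvector of the pencil `(C, B)` for a nonzero
eigenvalue, then `C U Bᵀ = B U Cᵀ` forces `C U = 0`. -/
theorem PosDef.mul_eq_zero_of_mul_mul_transpose_eq [DecidableEq n] {B C U : Matrix n n ℂ}
    (hB : B.PosDef) (hC : C.IsHermitian)
    (heig : ∀ θ : ℂ, θ ≠ 0 → ∀ v, v ≠ 0 → C *ᵥ v = θ • B *ᵥ v → ¬ ∃ y, v = U *ᵥ y)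
    (hU : C * U * Bᵀ = B * U * Cᵀ) : C * U = 0 := by
  have hBdet : IsUnit B.det := (isUnit_iff_isUnit_det B).1 hB.isUnit
  have hBT : IsUnit Bᵀ.det := by rwa [det_transpose]
  have hinv : B⁻¹ * C * U = U * (Cᵀ * Bᵀ⁻¹) := by
    calc B⁻¹ * C * U = B⁻¹ * (C * U * Bᵀ) * Bᵀ⁻¹ := by
          rw [Matrix.mul_assoc B⁻¹ (C * U * Bᵀ), mul_nonsing_inv_cancel_right _ _ hBT,
            Matrix.mul_assoc]
      _ = U * (Cᵀ * Bᵀ⁻¹) := by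
          rw [hU, Matrix.mul_assoc B, nonsing_inv_mul_cancel_left _ _ hBdet, Matrix.mul_assoc]
  have hmaps : ∀ w ∈ LinearMap.range U.mulVecLin,
      (B⁻¹ * C).mulVecLin w ∈ LinearMap.range U.mulVecLin := by
    rintro _ ⟨y, rfl⟩
    refine ⟨(Cᵀ * Bᵀ⁻¹) *ᵥ y, ?_⟩
    simp only [mulVecLin_apply, mulVec_mulVec, hinv]
  have hBC : ∀ w, B *ᵥ ((B⁻¹ * C) *ᵥ w) = C *ᵥ w := fun w ↦ by
    rw [mulVec_mulVec, mul_nonsing_inv_cancel_left _ _ hBdet]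
  have hf : (B⁻¹ * C).mulVecLin.restrict hmaps = 0 := by
    refine Module.End.eq_zero_of_forall_not_hasEigenvalue _ ?_ ?_
    · rintro ⟨w, hw⟩ h
      have h' : (B⁻¹ * C) *ᵥ ((B⁻¹ * C) *ᵥ w) = 0 := congrArg Subtype.val h
      have h0 : C *ᵥ w = 0 := hB.mulVec_eq_zero_of_mulVec_inv_mul_mulVec_eq_zero hC <| by
        rw [← hBC, h', mulVec_zero]
      refine Subtype.ext ?_
      change (B⁻¹ * C) *ᵥ w = 0
      rw [← mulVec_mulVec, h0, mulVec_zero]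
    · intro μ hμ h
      obtain ⟨⟨w, y, rfl⟩, hw⟩ := h.exists_hasEigenvector
      have h' : (B⁻¹ * C) *ᵥ (U *ᵥ y) = μ • (U *ᵥ y) := congrArg Subtype.val hw.apply_eq_smul
      refine heig μ hμ (U *ᵥ y) (fun h0 ↦ hw.2 (Subtype.ext h0)) ?_ ⟨y, rfl⟩
      rw [← hBC, h', mulVec_smul]
  refine ext_of_mulVec_single fun i ↦ ?_
  have h' : (B⁻¹ * C) *ᵥ (U *ᵥ Pi.single i 1) = 0 :=
    congrArg Subtype.val (LinearMap.congr_fun hf ⟨_, Pi.single i 1, rfl⟩)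
  rw [← mulVec_mulVec, ← hBC, h', mulVec_zero, zero_mulVec]

/-- The lower block `Y` of a kernel vector of the operator determinant vanishes. -/
theorem PosDef.eq_zero_of_block_equations {B C Q Y : Matrix n n ℂ} {R : Matrix n m ℂ}
    {X : Matrix m n ℂ} (hB : B.PosDef) (hC : C.IsHermitian) (hQ : Q.PosDef)
    (h₁ : Rᴴ * C * Y * Bᵀ = Rᴴ * B * Y * Cᵀ)
    (h₂ : (C * R * X + Q * Y) * Bᵀ = B * R * X * Cᵀ) : Y = 0 := by
  classical
  have hBc : Bᵀᴴ = Bᵀ := hB.isHermitian.transpose.eq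
  have hCc : Cᵀᴴ = Cᵀ := hC.transpose.eq
  have h₁' : Bᵀ * (Yᴴ * (C * R)) = Cᵀ * (Yᴴ * (B * R)) := by
    have := congrArg (fun M ↦ Mᴴ) h₁
    simpa only [conjTranspose_mul, conjTranspose_conjTranspose, hBc, hCc, hB.isHermitian.eq, hC.eq,
      Matrix.mul_assoc]
      using this
  have htr : trace (Yᴴ * (Q * Y * Bᵀ)) = 0 := by
    have hsub : Q * Y * Bᵀ = B * R * X * Cᵀ - C * R * X * Bᵀ := by
      rw [← h₂, Matrix.add_mul, add_sub_cancel_left]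
    have hB' : trace (Yᴴ * (C * R * X * Bᵀ)) = trace (Bᵀ * (Yᴴ * (C * R)) * X) := by
      rw [← Matrix.mul_assoc, trace_mul_comm]
      simp only [Matrix.mul_assoc]
    have hC' : trace (Yᴴ * (B * R * X * Cᵀ)) = trace (Cᵀ * (Yᴴ * (B * R)) * X) := by
      rw [← Matrix.mul_assoc, trace_mul_comm]
      simp only [Matrix.mul_assoc]
    rw [hsub, Matrix.mul_sub, trace_sub, hB', hC', h₁', sub_self]
  by_contra hY
  have hpos := (hB.kronecker hQ).dotProduct_mulVec_pos (vec_eq_zero_iff.not.2 hY)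
  rw [kronecker_mulVec_vec, star_vec_dotProduct_vec, htr] at hpos
  exact hpos.false

end Matrix

theorem stmt_16 (n : ℕ) (hn : 0 < n)
    (A B C P Q : Matrix (Fin n) (Fin n) ℂ)
    (hA : A.IsHermitian) (hC : C.IsHermitian) (hP : P.IsHermitian)
    (hB : B.PosDef) (hQ : Q.PosDef)
    (R : Matrix (Fin n) (Fin (n - 1)) ℂ) (hR : Function.Injective R.mulVec)
    (Ahat : Matrix (Fin (n - 1) ⊕ Fin n) (Fin (n - 1) ⊕ Fin n) ℂ)
    (hAhat : Ahat = Matrix.fromBlocks 0 (Rᴴ * A) (A * R) P)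
    (Bhat : Matrix (Fin (n - 1) ⊕ Fin n) (Fin (n - 1) ⊕ Fin n) ℂ)
    (hBhat : Bhat = Matrix.fromBlocks 0 (Rᴴ * B) (B * R) 0)
    (Chat : Matrix (Fin (n - 1) ⊕ Fin n) (Fin (n - 1) ⊕ Fin n) ℂ)
    (hChat : Chat = Matrix.fromBlocks 0 (Rᴴ * C) (C * R) Q)
    (Δ₀ Δ₁ : Matrix (Fin n × (Fin (n - 1) ⊕ Fin n)) (Fin n × (Fin (n - 1) ⊕ Fin n)) ℂ)
    (hΔ₀ : Δ₀ = B ⊗ₖ Chat - C ⊗ₖ Bhat)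
    (hΔ₁ : Δ₁ = A ⊗ₖ Chat - C ⊗ₖ Ahat)
    (hrankC : C.rank < n - 1)
    (heig : ∀ (θ : ℂ), θ ≠ 0 → ∀ v : Fin n → ℂ, v ≠ 0 →
      C.mulVec v = θ • B.mulVec v → ¬ ∃ x : Fin (n - 1) → ℂ, v = R.mulVec x) :
    ∀ z : Fin n × (Fin (n - 1) ⊕ Fin n) → ℂ, Δ₀.mulVec z = 0 →
      Δ₁.mulVec z = 0 ∧ ∀ σ : ℂ, (Δ₁ - σ • Δ₀).mulVec z = 0 := by
  intro z hz
  suffices h : Δ₁ *ᵥ z = 0 from ⟨h, fun σ ↦ by rw [sub_mulVec, smul_mulVec, hz, h]; simp⟩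
  obtain ⟨Z, rfl⟩ := vec_bijective.2 z
  obtain ⟨X, Y, rfl⟩ : ∃ X Y, Z = fromRows X Y := ⟨_, _, (fromRows_toRows Z).symm⟩
  subst hΔ₀ hΔ₁ hAhat hBhat hChat
  rw [sub_mulVec, kronecker_mulVec_vec, kronecker_mulVec_vec, sub_eq_zero, vec_inj,
    fromBlocks_mul_fromRows, fromBlocks_mul_fromRows, fromRows_mul, fromRows_mul,
    fromRows_inj.eq_iff] at hz
  simp only [Matrix.zero_mul, zero_add, add_zero] at hz
  obtain ⟨h₁, h₂⟩ := hz
  obtain rfl : Y = 0 := hB.eq_zero_of_block_equations hC hQ h₁ h₂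
  rw [Matrix.mul_zero, add_zero, Matrix.mul_assoc C, Matrix.mul_assoc B] at h₂
  have hCU : C * (R * X) = 0 := by
    refine hB.mul_eq_zero_of_mul_mul_transpose_eq hC (fun θ hθ v hv hCv ↦ ?_) h₂
    rintro ⟨y, rfl⟩
    exact heig θ hθ _ hv hCv ⟨X *ᵥ y, (mulVec_mulVec _ _ _).symm⟩
  have hUC : R * X * Cᵀ = 0 := by
    have hBU : B * (R * X * Cᵀ) = 0 := by
      rw [← Matrix.mul_assoc, ← h₂, hCU, Matrix.zero_mul]
    rw [← nonsing_inv_mul_cancel_left B (R * X * Cᵀ) ((isUnit_iff_isUnit_det B).1 hB.isUnit),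
      hBU, Matrix.mul_zero]
  rw [sub_mulVec, kronecker_mulVec_vec, kronecker_mulVec_vec, sub_eq_zero, vec_inj,
    fromBlocks_mul_fromRows, fromBlocks_mul_fromRows, fromRows_mul, fromRows_mul]
  simp only [Matrix.zero_mul, Matrix.mul_zero, add_zero]
  rw [Matrix.mul_assoc C, hCU, Matrix.mul_assoc A, Matrix.mul_assoc A, hUC]
  simp
end

section
/- Assume rank(C) < n − 1 and assume that no eigenvector of the pencil (C, B) corresponding to a nonzero eigenvalue lies in the column space of R: for every θ ∈ ℂ with θ ≠ 0 and every nonzero v ∈ ℂⁿ with C *ᵥ v = θ·(B *ᵥ v), there is no x ∈ ℂ^{n−1} with v = R *ᵥ x. If (λ, v) solves the NEPv with v ≠ 0 and C *ᵥ v ≠ 0, then rank(Δ₁ − λ·Δ₀) < rank(Δ₀). -/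
open Matrix
open scoped ComplexOrder Kronecker

/-- A Hermitian matrix and a positive definite one are simultaneously diagonalizable by
congruence, so their pencil has a full set of eigenvectors with real eigenvalues. -/
theorem Matrix.PosDef.exists_isUnit_mul_eq_mul_mul_diagonal {ι : Type*} [Fintype ι]
    [DecidableEq ι] {B C : Matrix ι ι ℂ} (hB : B.PosDef) (hC : C.IsHermitian) :
    ∃ (V : Matrix ι ι ℂ) (d : ι → ℝ),
      IsUnit V ∧ C * V = B * V * diagonal (fun i ↦ (d i : ℂ)) := by
  obtain ⟨L, hL⟩ : ∃ L : Matrix ι ι ℂ, B = Lᴴ * L := by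
    open scoped MatrixOrder in
    exact CStarAlgebra.nonneg_iff_eq_star_mul_self.mp hB.posSemidef.nonneg
  have hLu : IsUnit L.det := by
    have := (Matrix.isUnit_iff_isUnit_det _).mp hB.isUnit
    rw [hL, det_mul] at this
    exact isUnit_of_mul_isUnit_right this
  have hK : ((L⁻¹)ᴴ * C * L⁻¹).IsHermitian := isHermitian_conjTranspose_mul_mul _ hC
  set U : Matrix ι ι ℂ := hK.eigenvectorUnitary.1
  have hU : ((L⁻¹)ᴴ * C * L⁻¹) * U = U * diagonal (fun i ↦ (hK.eigenvalues i : ℂ)) := by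
    ext i j
    have := congrFun (hK.mulVec_eigenvectorBasis j) i
    rw [mul_diagonal]
    simpa [U, mul_apply, mulVec, dotProduct, mul_comm] using this
  have hLL : Lᴴ * (L⁻¹)ᴴ = 1 := by
    rw [← conjTranspose_mul, nonsing_inv_mul _ hLu, conjTranspose_one]
  refine ⟨L⁻¹ * U, hK.eigenvalues, ?_, ?_⟩
  · exact ((isUnit_nonsing_inv_iff).mpr ((isUnit_iff_isUnit_det _).mpr hLu)).mul
      (Unitary.isUnit_coe (U := hK.eigenvectorUnitary))
  · calc C * (L⁻¹ * U) = (Lᴴ * (L⁻¹)ᴴ) * C * (L⁻¹ * U) := by rw [hLL, Matrix.one_mul]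
      _ = Lᴴ * ((L⁻¹)ᴴ * C * L⁻¹ * U) := by simp only [Matrix.mul_assoc]
      _ = Lᴴ * (L * L⁻¹) * (U * diagonal (fun i ↦ (hK.eigenvalues i : ℂ))) := by
        rw [hU, mul_nonsing_inv _ hLu, Matrix.mul_one]
      _ = _ := by rw [hL]; simp only [Matrix.mul_assoc]

theorem Matrix.eq_zero_of_mul_isUnit_eq_zero {ι κ : Type*} [Fintype ι] [DecidableEq ι]
    {M : Matrix κ ι ℂ} {W : Matrix ι ι ℂ} (hW : IsUnit W) (h : M * W = 0) : M = 0 := by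
  rw [← mul_nonsing_inv_cancel_right W M ((isUnit_iff_isUnit_det W).mp hW), h, Matrix.zero_mul]

theorem Matrix.IsHermitian.star_dotProduct_mulVec_comm {ι : Type*} [Fintype ι]
    {H : Matrix ι ι ℂ} (hH : H.IsHermitian) (x y : ι → ℂ) :
    star (star x ⬝ᵥ H *ᵥ y) = star y ⬝ᵥ H *ᵥ x := by
  rw [star_dotProduct, star_star, star_mulVec, hH.eq, dotProduct_mulVec, dotProduct_comm]

/-- A saddle point system with positive definite block `Q` only has solutions supported on the
kernel of its off-diagonal block. -/
theorem Matrix.PosDef.saddlePoint_mulVec_eq_zero {ι κ : Type*} [Fintype ι] [Fintype κ]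
    {Q : Matrix ι ι ℂ} (hQ : Q.PosDef) (K : Matrix ι κ ℂ) {f : κ ⊕ ι → ℂ}
    (hf : fromBlocks 0 Kᴴ K Q *ᵥ f = 0) :
    K *ᵥ (f ∘ Sum.inl) = 0 ∧ f ∘ Sum.inr = 0 := by
  rw [fromBlocks_mulVec] at hf
  have h1 : Kᴴ *ᵥ (f ∘ Sum.inr) = 0 := by
    ext i; simpa using congrFun hf (Sum.inl i)
  have h2 : K *ᵥ (f ∘ Sum.inl) + Q *ᵥ (f ∘ Sum.inr) = 0 := by
    ext i; simpa using congrFun hf (Sum.inr i)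
  have h3 : f ∘ Sum.inr = 0 := by
    by_contra hz
    have h4 := hQ.dotProduct_mulVec_pos hz
    have h5 : star (f ∘ Sum.inr) ⬝ᵥ K *ᵥ (f ∘ Sum.inl) = 0 := by
      rw [dotProduct_mulVec, ← conjTranspose_conjTranspose K, ← star_mulVec, h1]
      simp
    have h6 := congrArg (star (f ∘ Sum.inr) ⬝ᵥ ·) h2
    simp only [dotProduct_add, h5, zero_add, dotProduct_zero] at h6
    exact h4.ne' h6
  refine ⟨?_, h3⟩
  simpa [h3] using h2

/-- If the pencil `Y - d X` is nonsingular at each nonzero real `d`, then the kernel of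
`B ⊗ Y - C ⊗ X`, written in matrix form, is contained in `ker C ⊗ ker Y`. -/
theorem Matrix.PosDef.mul_eq_zero_of_mul_mul_transpose_eq_s17 {ι κ : Type*} [Fintype ι] [DecidableEq ι]
    [Fintype κ]
    {B C : Matrix ι ι ℂ} {X Y : Matrix κ κ ℂ} (hB : B.PosDef) (hC : C.IsHermitian)
    (h0 : ∀ (d : ℝ), d ≠ 0 → ∀ f : κ → ℂ, Y *ᵥ f = (d : ℂ) • X *ᵥ f → f = 0)
    {U : Matrix κ ι ℂ} (hU : Y * U * Bᵀ = X * U * Cᵀ) :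
    Y * U = 0 ∧ U * Cᵀ = 0 := by
  obtain ⟨V, d, hV, hd⟩ :=
    hB.transpose.exists_isUnit_mul_eq_mul_mul_diagonal hC.transpose
  have hBu : IsUnit (Bᵀ) := hB.transpose.isUnit
  set F := U * (Bᵀ * V) with hF
  have hYF : Y * F = X * F * diagonal (fun i ↦ (d i : ℂ)) := by
    rw [hF, ← Matrix.mul_assoc, ← Matrix.mul_assoc, hU, Matrix.mul_assoc, hd]
    simp only [Matrix.mul_assoc]
  have hcol (i : ι) : Y *ᵥ F.col i = (d i : ℂ) • X *ᵥ F.col i := by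
    ext k
    have := congrFun (congrFun hYF k) i
    rw [mul_diagonal] at this
    simpa [mul_apply, mulVec, dotProduct, mul_comm] using this
  have hcol0 (i : ι) : d i = 0 ∨ F.col i = 0 := by
    by_cases h : d i = 0
    · exact .inl h
    · exact .inr (h0 _ h _ (hcol i))
  have hFD : F * diagonal (fun i ↦ (d i : ℂ)) = 0 := by
    ext k i
    rw [mul_diagonal]
    rcases hcol0 i with h | h
    · simp [h]
    · simp [show F k i = 0 from congrFun h k]
  constructor
  · have h1 : Y * U * (Bᵀ * V) = 0 := by
      rw [Matrix.mul_assoc, ← hF, hYF, Matrix.mul_assoc, hFD, Matrix.mul_zero]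
    exact eq_zero_of_mul_isUnit_eq_zero (hBu.mul hV) h1
  · have h1 : U * Cᵀ * V = 0 := by
      rw [Matrix.mul_assoc, hd, ← Matrix.mul_assoc, ← hF, hFD]
    exact eq_zero_of_mul_isUnit_eq_zero hV h1

/-- If `M` is a singular Hermitian matrix with null vector `v` and `v* S v = 0`, then the bordered
matrix built from `M * R` and `S` is singular as soon as `R` has one column less than `M`. -/
theorem exists_ne_zero_bordered_mulVec_eq_zero {n : ℕ} (hn : 0 < n)
    {M S : Matrix (Fin n) (Fin n) ℂ} (R : Matrix (Fin n) (Fin (n - 1)) ℂ)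
    (hM : M.IsHermitian) {v : Fin n → ℂ} (hv : v ≠ 0) (hMv : M *ᵥ v = 0)
    (hS : star v ⬝ᵥ S *ᵥ v = 0) :
    ∃ w : Fin (n - 1) ⊕ Fin n → ℂ, w ≠ 0 ∧ fromBlocks 0 (Rᴴ * M) (M * R) S *ᵥ w = 0 := by
  let T : ((Fin (n - 1) → ℂ) × ℂ) →ₗ[ℂ] (Fin n → ℂ) :=
    (M * R).mulVecLin.coprod (LinearMap.toSpanSingleton ℂ _ (S *ᵥ v))
  have hT (p) : T p = (M * R) *ᵥ p.1 + p.2 • S *ᵥ v := rfl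
  have horth (p) : star v ⬝ᵥ T p = 0 := by
    have h1 : star v ᵥ* M = 0 := by
      rw [← hM.eq, ← star_mulVec, hMv, star_zero]
    rw [hT, dotProduct_add, dotProduct_smul, hS, dotProduct_mulVec, ← vecMul_vecMul, h1]
    simp
  have hdim : Module.finrank ℂ ((Fin (n - 1) → ℂ) × ℂ) = Module.finrank ℂ (Fin n → ℂ) := by
    simp; omega
  have hinj : ¬ Function.Injective T := by
    rw [LinearMap.injective_iff_surjective_of_finrank_eq_finrank hdim]
    intro hs
    obtain ⟨p, hp⟩ := hs v
    have := horth p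
    rw [hp, dotProduct_star_self_eq_zero] at this
    exact hv this
  rw [injective_iff_map_eq_zero] at hinj
  push Not at hinj
  obtain ⟨⟨x, t⟩, hp, hne⟩ := hinj
  refine ⟨Sum.elim x (t • v), ?_, ?_⟩
  · intro h
    have hx : x = 0 := funext fun i ↦ congrFun h (Sum.inl i)
    have ht : t • v = 0 := funext fun i ↦ congrFun h (Sum.inr i)
    have ht : t = 0 := (smul_eq_zero.mp ht).resolve_right hv
    exact hne (by simp [hx, ht])
  · rw [fromBlocks_mulVec, Sum.elim_comp_inl, Sum.elim_comp_inr, mulVec_smul, mulVec_smul,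
      ← mulVec_mulVec v, hMv, ← hT (x, t), hp]
    ext (i | i) <;> simp

/-- A quotient of Hermitian forms is real. -/
theorem Matrix.IsHermitian.star_dotProduct_div {ι : Type*} [Fintype ι]
    {P Q : Matrix ι ι ℂ} (hP : P.IsHermitian) (hQ : Q.IsHermitian) (x : ι → ℂ) :
    star ((star x ⬝ᵥ P *ᵥ x) / (star x ⬝ᵥ Q *ᵥ x)) =
      (star x ⬝ᵥ P *ᵥ x) / (star x ⬝ᵥ Q *ᵥ x) := by
  rw [star_div₀, hP.star_dotProduct_mulVec_comm, hQ.star_dotProduct_mulVec_comm]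

/-- Matrices with strictly nested kernels have strictly ordered ranks. -/
theorem Matrix.rank_lt_rank_of_mulVec_eq_zero {ι : Type*} [Fintype ι]
    {M N : Matrix ι ι ℂ} (h : ∀ u, N *ᵥ u = 0 → M *ᵥ u = 0) {u : ι → ℂ}
    (hM : M *ᵥ u = 0) (hN : N *ᵥ u ≠ 0) : M.rank < N.rank := by
  have hlt : LinearMap.ker N.mulVecLin < LinearMap.ker M.mulVecLin :=
    SetLike.lt_iff_le_and_exists.mpr ⟨fun x hx ↦ h x hx, u, hM, hN⟩
  have h1 := Submodule.finrank_lt_finrank_of_lt hlt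
  have h2 := LinearMap.finrank_range_add_finrank_ker M.mulVecLin
  have h3 := LinearMap.finrank_range_add_finrank_ker N.mulVecLin
  rw [rank, rank]
  omega

theorem stmt_17 (n : ℕ) (hn : 0 < n)
    (A B C P Q : Matrix (Fin n) (Fin n) ℂ)
    (hA : A.IsHermitian) (hC : C.IsHermitian) (hP : P.IsHermitian)
    (hB : B.PosDef) (hQ : Q.PosDef)
    (R : Matrix (Fin n) (Fin (n - 1)) ℂ) (hR : Function.Injective R.mulVec)
    (Ahat : Matrix (Fin (n - 1) ⊕ Fin n) (Fin (n - 1) ⊕ Fin n) ℂ)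
    (hAhat : Ahat = Matrix.fromBlocks 0 (Rᴴ * A) (A * R) P)
    (Bhat : Matrix (Fin (n - 1) ⊕ Fin n) (Fin (n - 1) ⊕ Fin n) ℂ)
    (hBhat : Bhat = Matrix.fromBlocks 0 (Rᴴ * B) (B * R) 0)
    (Chat : Matrix (Fin (n - 1) ⊕ Fin n) (Fin (n - 1) ⊕ Fin n) ℂ)
    (hChat : Chat = Matrix.fromBlocks 0 (Rᴴ * C) (C * R) Q)
    (Δ₀ Δ₁ : Matrix (Fin n × (Fin (n - 1) ⊕ Fin n)) (Fin n × (Fin (n - 1) ⊕ Fin n)) ℂ)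
    (hΔ₀ : Δ₀ = B ⊗ₖ Chat - C ⊗ₖ Bhat)
    (hΔ₁ : Δ₁ = A ⊗ₖ Chat - C ⊗ₖ Ahat)
    (hrankC : C.rank < n - 1)
    (heig : ∀ (θ : ℂ), θ ≠ 0 → ∀ v : Fin n → ℂ, v ≠ 0 →
      C.mulVec v = θ • B.mulVec v → ¬ ∃ x : Fin (n - 1) → ℂ, v = R.mulVec x)
    (lam : ℂ) (v : Fin n → ℂ) (hv : v ≠ 0) (hCv : C.mulVec v ≠ 0)
    (hNEPv : A.mulVec v = lam • B.mulVec v +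
      ((star v ⬝ᵥ P.mulVec v) / (star v ⬝ᵥ Q.mulVec v)) • C.mulVec v) :
    (Δ₁ - lam • Δ₀).rank < Δ₀.rank := by
  have hCB (d : ℝ) (hd : d ≠ 0) (f) (hf : Chat *ᵥ f = (d : ℂ) • Bhat *ᵥ f) : f = 0 := by
    have hK : ((C - (d : ℂ) • B) * R)ᴴ = Rᴴ * (C - (d : ℂ) • B) := by
      rw [conjTranspose_mul, conjTranspose_sub, conjTranspose_smul, hC.eq, hB.1.eq]
      simp
    have hblock : fromBlocks 0 ((C - (d : ℂ) • B) * R)ᴴ ((C - (d : ℂ) • B) * R) Q =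
        Chat - (d : ℂ) • Bhat := by
      rw [hK, hChat, hBhat]
      ext (i | i) (j | j) <;> simp [Matrix.mul_sub, Matrix.sub_mul]
    obtain ⟨h1, h2⟩ := hQ.saddlePoint_mulVec_eq_zero ((C - (d : ℂ) • B) * R) (f := f) (by
      rw [hblock, sub_mulVec, smul_mulVec, hf, sub_self])
    have h3 : R *ᵥ (f ∘ Sum.inl) = 0 := by
      by_contra hne
      refine heig d (by exact_mod_cast hd) _ hne ?_ ⟨_, rfl⟩
      rwa [← mulVec_mulVec, sub_mulVec, smul_mulVec, sub_eq_zero] at h1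
    have h4 : f ∘ Sum.inl = 0 := hR (h3.trans (mulVec_zero R).symm)
    ext (i | i)
    · exact congrFun h4 i
    · exact congrFun h2 i
  have hker (U : Matrix (Fin (n - 1) ⊕ Fin n) (Fin n) ℂ) (hU : Δ₀ *ᵥ vec U = 0) :
      Chat * U = 0 ∧ U * Cᵀ = 0 := by
    rw [hΔ₀, sub_mulVec, kronecker_mulVec_vec, kronecker_mulVec_vec, sub_eq_zero, vec_inj] at hU
    exact hB.mul_eq_zero_of_mul_mul_transpose_eq_s17 hC hCB hU
  have hpencil : Δ₁ - lam • Δ₀ = (A - lam • B) ⊗ₖ Chat - C ⊗ₖ (Ahat - lam • Bhat) := by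
    rw [hΔ₁, hΔ₀]
    ext ⟨i, k⟩ ⟨j, l⟩
    simp [kroneckerMap_apply]
    ring
  set μ := (star v ⬝ᵥ P *ᵥ v) / (star v ⬝ᵥ Q *ᵥ v) with hμ
  have hμs : star μ = μ := hP.star_dotProduct_div hQ.1 v
  have hBv : star v ⬝ᵥ B *ᵥ v ≠ 0 := (hB.dotProduct_mulVec_pos hv).ne'
  have hQv : star v ⬝ᵥ Q *ᵥ v ≠ 0 := (hQ.dotProduct_mulVec_pos hv).ne'
  have hlams : star lam = lam := by
    have h1 := congrArg (star v ⬝ᵥ ·) hNEPv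
    simp only [dotProduct_add, dotProduct_smul, smul_eq_mul] at h1
    have h2 := congrArg star h1
    simp only [star_add, star_mul', hA.star_dotProduct_mulVec_comm,
      hB.1.star_dotProduct_mulVec_comm, hC.star_dotProduct_mulVec_comm, hμs] at h2
    exact mul_right_cancel₀ hBv (add_right_cancel (h2.symm.trans h1))
  have hM : (A - lam • B - μ • C).IsHermitian := by
    rw [IsHermitian, conjTranspose_sub, conjTranspose_sub, conjTranspose_smul,
      conjTranspose_smul, hA.eq, hB.1.eq, hC.eq, hlams, hμs]
  have hMv : (A - lam • B - μ • C) *ᵥ v = 0 := by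
    rw [sub_mulVec, sub_mulVec, smul_mulVec, smul_mulVec, hNEPv]
    abel
  have hSv : star v ⬝ᵥ (P - μ • Q) *ᵥ v = 0 := by
    rw [sub_mulVec, smul_mulVec, dotProduct_sub, dotProduct_smul, smul_eq_mul, hμ,
      div_mul_cancel₀ _ hQv, sub_self]
  obtain ⟨w, hw, hMw⟩ := exists_ne_zero_bordered_mulVec_eq_zero hn R hM hv hMv hSv
  have hhat : fromBlocks 0 (Rᴴ * (A - lam • B - μ • C)) ((A - lam • B - μ • C) * R) (P - μ • Q) =
      Ahat - lam • Bhat - μ • Chat := by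
    rw [hAhat, hBhat, hChat]
    ext (i | i) (j | j) <;> simp [Matrix.mul_sub, Matrix.sub_mul]
  rw [hhat, sub_mulVec, smul_mulVec, sub_eq_zero] at hMw
  rw [sub_mulVec, smul_mulVec, sub_eq_zero] at hMv
  rw [hpencil]
  refine rank_lt_rank_of_mulVec_eq_zero (u := vec (vecMulVec w v)) (fun u hu ↦ ?_) ?_ ?_
  · obtain ⟨U, rfl⟩ := vec_bijective.surjective u
    obtain ⟨h1, h2⟩ := hker U hu
    rw [sub_mulVec, kronecker_mulVec_vec, kronecker_mulVec_vec, h1, Matrix.mul_assoc _ U, h2]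
    simp
  · rw [sub_mulVec, kronecker_mulVec_vec, kronecker_mulVec_vec, mul_vecMulVec, mul_vecMulVec,
      vecMulVec_mul, vecMulVec_mul, vecMul_transpose, vecMul_transpose, hMv, hMw,
      vecMulVec_smul, smul_vecMulVec, sub_self]
  · intro h0
    have h1 := (hker _ h0).2
    rw [vecMulVec_mul, vecMul_transpose] at h1
    obtain ⟨k, hk⟩ := Function.ne_iff.mp hw
    obtain ⟨i, hi⟩ := Function.ne_iff.mp hCv
    exact mul_ne_zero hk hi (congrFun (congrFun h1 k) i)
end

section
/- Let r = rank(C) and assume r < n − 1. Define f(λ,μ) = det(A − λ·B − μ·C) and g(λ,μ) = trace((P − μ·Q) * adjugate(A − λ·B − μ·C)), and let T = {(λ,μ) ∈ ℂ × ℂ : f(λ,μ) = 0 and g(λ,μ) = 0}. Let I be the set of points (λ,μ) ∈ T with λ ≠ 0 and μ ≠ 0 that are isolated points of T (each such point has a neighborhood in ℂ × ℂ whose intersection with T is exactly that point). Then I is finite with cardinality at most n·(2r + 1) − r·(r + 1). -/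
open Matrix
open scoped ComplexOrder

namespace MvPolynomial

/-- Exponents of bivariate monomials of total degree at most `D` and degree at most `E` in the
second variable. -/
def trapezoid (D E : ℕ) : Set (Fin 2 →₀ ℕ) := {m | m 0 + m 1 ≤ D ∧ m 1 ≤ E}

lemma trapezoid_eq_image (D E : ℕ) :
    trapezoid D E = (fun x : (_ : ℕ) × ℕ => Finsupp.equivFunOnFinite.symm ![x.2, x.1]) ''
      ((Finset.range (E + 1)).sigma fun b => Finset.range (D + 1 - b) : Finset _) := by
  ext m
  simp only [trapezoid, Set.mem_ofPred_eq, Set.mem_image, Finset.mem_coe, Finset.mem_sigma,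
    Finset.mem_range]
  constructor
  · rintro ⟨h1, h2⟩
    refine ⟨⟨m 1, m 0⟩, ⟨by lia, by lia⟩, ?_⟩
    ext i
    fin_cases i <;> rfl
  · rintro ⟨⟨b, a⟩, ⟨h1, h2⟩, rfl⟩
    simp only [Finsupp.equivFunOnFinite_symm_apply_apply, cons_val_zero, cons_val_one]
    lia

lemma finite_trapezoid (D E : ℕ) : (trapezoid D E).Finite := by
  rw [trapezoid_eq_image]
  exact (Finset.finite_toSet _).image _

lemma two_mul_ncard_trapezoid {D E : ℕ} (h : E ≤ D) :
    2 * (trapezoid D E).ncard + E * (E + 1) = 2 * (E + 1) * (D + 1) := by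
  rw [trapezoid_eq_image, Set.ncard_image_of_injective, Set.ncard_coe_finset, Finset.card_sigma]
  · simp only [Finset.card_range]
    induction E with
    | zero => simp
    | succ E ih =>
      rw [Finset.sum_range_succ]
      have := ih (by lia)
      obtain ⟨d, rfl⟩ := Nat.exists_eq_add_of_le h
      have e : E + 1 + d + 1 - (E + 1) = d + 1 := by lia
      rw [e]
      nlinarith
  · rintro ⟨b, a⟩ ⟨b', a'⟩ h
    have h' := Finsupp.equivFunOnFinite.symm.injective h
    have h0 := congrFun h' 0
    have h1 := congrFun h' 1
    simp_all

section Field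

variable {K : Type*} [Field K]

lemma mem_restrictSupport_trapezoid {D E : ℕ} {p : MvPolynomial (Fin 2) K} :
    p ∈ restrictSupport K (trapezoid D E) ↔ p.totalDegree ≤ D ∧ p.degreeOf 1 ≤ E := by
  have hsum (m : Fin 2 →₀ ℕ) : (m.sum fun _ e => e) = m 0 + m 1 := by
    rw [Finsupp.sum_fintype _ _ fun _ => rfl, Fin.sum_univ_two]
  rw [mem_restrictSupport_iff, degreeOf_le_iff, totalDegree, Finset.sup_le_iff]
  simp only [trapezoid, Set.subset_def, Finset.mem_coe, Set.mem_ofPred_eq, forall_and,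
    hsum]

instance (D E : ℕ) : FiniteDimensional K (restrictSupport K (trapezoid D E)) :=
  have := (finite_trapezoid D E).to_subtype
  .of_basis (basisRestrictSupport K _)

lemma two_mul_finrank_restrictSupport_trapezoid {D E : ℕ} (h : E ≤ D) :
    2 * Module.finrank K (restrictSupport K (trapezoid D E)) + E * (E + 1) =
      2 * (E + 1) * (D + 1) := by
  rw [Module.finrank_eq_nat_card_basis (basisRestrictSupport K _), Nat.card_coe_set_eq,
    two_mul_ncard_trapezoid h]

lemma exists_eval_eq_zero_and_ne_zero {σ : Type*} (S : Finset (σ → K)) (p : σ → K) :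
    ∃ L : MvPolynomial σ K, eval p L ≠ 0 ∧ ∀ q ∈ S, q ≠ p → eval q L = 0 := by
  classical
  induction S using Finset.induction_on with
  | empty => exact ⟨1, by simp⟩
  | insert q S _ ih =>
    obtain ⟨L, hL, hS⟩ := ih
    by_cases hq : q = p
    · exact ⟨L, hL, by simpa [hq] using hS⟩
    · obtain ⟨i, hi⟩ := Function.ne_iff.mp hq
      refine ⟨L * (X i - C (q i)), ?_, ?_⟩
      · simpa [hL, sub_eq_zero] using Ne.symm hi
      · intro q' hq' hne
        rcases Finset.mem_insert.mp hq' with rfl | hq'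
        · simp
        · simp [hS q' hq' hne]

/-- Evaluation at the points of `S`. -/
noncomputable def evalOn {σ : Type*} (S : Finset (σ → K)) : MvPolynomial σ K →ₗ[K] S → K :=
  LinearMap.pi fun q => (aeval q.1).toLinearMap

@[simp] lemma evalOn_apply {σ : Type*} (S : Finset (σ → K)) (p : MvPolynomial σ K) (q : S) :
    evalOn S p q = eval q.1 p := by
  simp [evalOn, aeval_eq_eval]

lemma exists_forall_le_evalOn_surjective (S : Finset (Fin 2 → K)) :
    ∃ k, ∀ D E, k ≤ D → k ≤ E → Function.Surjective
      ((evalOn S).domRestrict (restrictSupport K (trapezoid D E))) := by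
  classical
  choose L hL hL' using exists_eval_eq_zero_and_ne_zero S
  refine ⟨S.sup fun p => (L p).totalDegree, fun D E hD hE v => ?_⟩
  have hmem : ∀ p : S, L p ∈ restrictSupport K (trapezoid D E) := fun p => by
    have := Finset.le_sup (f := fun p => (L p).totalDegree) p.2
    exact mem_restrictSupport_trapezoid.mpr
      ⟨this.trans hD, (degreeOf_le_totalDegree _ _).trans (this.trans hE)⟩
  refine ⟨∑ p : S, (v p / eval p.1 (L p)) • ⟨L p, hmem p⟩, ?_⟩
  ext q
  rw [map_sum, Finset.sum_apply, Finset.sum_eq_single q]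
  · simp [LinearMap.domRestrict_apply, hL]
  · intro p _ hpq
    simp [LinearMap.domRestrict_apply, hL' p q q.2 (fun h => hpq (Subtype.ext h.symm))]
  · simp

/-- A Bézout bound for relatively prime bivariate polynomials that takes into account both the
total degree and the degree in the second variable. -/
theorem card_add_mul_le_of_isRelPrime {F G : MvPolynomial (Fin 2) K} (hG : G ≠ 0)
    (hFG : IsRelPrime F G) (S : Finset (Fin 2 → K)) (hSF : ∀ q ∈ S, eval q F = 0)
    (hSG : ∀ q ∈ S, eval q G = 0) :
    S.card + F.degreeOf 1 * G.degreeOf 1 ≤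
      F.degreeOf 1 * G.totalDegree + F.totalDegree * G.degreeOf 1 := by
  obtain ⟨k, hk⟩ := exists_forall_le_evalOn_surjective S
  set r := F.degreeOf 1
  set m := F.totalDegree
  set s := G.degreeOf 1
  set d := G.totalDegree
  have hrm : r ≤ m := degreeOf_le_totalDegree _ _
  have hsd : s ≤ d := degreeOf_le_totalDegree _ _
  let V (D E : ℕ) := restrictSupport K (trapezoid D E)
  have mulF {D E : ℕ} {a : MvPolynomial (Fin 2) K} (ha : a ∈ V D E) :
      F * a ∈ V (D + m) (E + r) := by
    rw [mem_restrictSupport_trapezoid] at ha ⊢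
    exact ⟨(totalDegree_mul _ _).trans (by lia), (degreeOf_mul_le _ _ _).trans (by lia)⟩
  have mulG {D E : ℕ} {a : MvPolynomial (Fin 2) K} (ha : a ∈ V D E) :
      G * a ∈ V (D + d) (E + s) := by
    rw [mem_restrictSupport_trapezoid] at ha ⊢
    exact ⟨(totalDegree_mul _ _).trans (by lia), (degreeOf_mul_le _ _ _).trans (by lia)⟩
  let φF : V (k + d) (k + s) →ₗ[K] V (k + d + m) (k + s + r) :=
    (LinearMap.mulLeft K F).restrict fun _ => mulF
  let φG : V (k + m) (k + r) →ₗ[K] V (k + d + m) (k + s + r) :=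
    (LinearMap.mulLeft K G).restrict fun a ha => by
      have := mulG ha
      rwa [add_right_comm k m d, add_right_comm k r s] at this
  let ψF : V k k →ₗ[K] V (k + m) (k + r) := (LinearMap.mulLeft K F).restrict fun _ => mulF
  let ψG : V k k →ₗ[K] V (k + d) (k + s) := (LinearMap.mulLeft K G).restrict fun _ => mulG
  let Φ := φF.coprod (-φG)
  let Ψ := ψG.prod ψF
  have hΦ (a b) : (Φ (a, b) : MvPolynomial (Fin 2) K) = F * a - G * b := (sub_eq_add_neg _ _).symm
  have hker : LinearMap.ker Φ ≤ LinearMap.range Ψ := by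
    rintro ⟨⟨a, ha⟩, ⟨b, hb⟩⟩ hab
    have hab' : F * a = G * b := by
      rw [← sub_eq_zero, ← hΦ ⟨a, ha⟩ ⟨b, hb⟩, LinearMap.mem_ker.mp hab, Submodule.coe_zero]
    obtain ⟨c, rfl⟩ : G ∣ a := hFG.symm.dvd_of_dvd_mul_left ⟨b, hab'⟩
    obtain rfl : F * c = b := mul_left_cancel₀ hG (by rw [← hab']; ring)
    have hc : c ∈ V k k := by
      rw [mem_restrictSupport_trapezoid] at ha ⊢
      rcases eq_or_ne c 0 with rfl | hc
      · simp
      · rw [totalDegree_mul_of_isDomain hG hc, degreeOf_mul_eq hG hc] at ha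
        lia
    exact ⟨⟨c, hc⟩, rfl⟩
  let ev := (evalOn S).domRestrict (V (k + d + m) (k + s + r))
  have hrange : LinearMap.range Φ ≤ LinearMap.ker ev := by
    rintro _ ⟨⟨a, b⟩, rfl⟩
    rw [LinearMap.mem_ker]
    ext q
    simp [ev, LinearMap.domRestrict_apply, hΦ, hSF q q.2, hSG q q.2]
  have h1 := LinearMap.finrank_range_add_finrank_ker Φ
  have h2 := LinearMap.finrank_range_add_finrank_ker ev
  have h3 := Submodule.finrank_mono hker
  have h4 := Submodule.finrank_mono hrange
  have h5 := LinearMap.finrank_range_le Ψ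
  rw [LinearMap.range_eq_top.mpr (hk _ _ (by lia) (by lia)), finrank_top,
    Module.finrank_fintype_fun_eq_card, Fintype.card_coe] at h2
  rw [Module.finrank_prod] at h1
  have e1 := two_mul_finrank_restrictSupport_trapezoid (K := K) (le_refl k)
  have e2 := two_mul_finrank_restrictSupport_trapezoid (K := K) (show k + s ≤ k + d by lia)
  have e3 := two_mul_finrank_restrictSupport_trapezoid (K := K) (show k + r ≤ k + m by lia)
  have e4 := two_mul_finrank_restrictSupport_trapezoid (K := K)
    (show k + s + r ≤ k + d + m by lia)
  nlinarith

end Field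
end MvPolynomial

lemma Polynomial.norm_leadingCoeff_mul_pow_le_norm_eval {p : Polynomial ℂ} {x : ℂ} {ε : ℝ}
    (hε : 0 ≤ ε) (h : ∀ z, p.IsRoot z → ε ≤ ‖x - z‖) :
    ‖p.leadingCoeff‖ * ε ^ p.natDegree ≤ ‖p.eval x‖ := by
  rcases eq_or_ne p 0 with rfl | hp
  · simp
  have hs := IsAlgClosed.splits p
  rw [hs.eval_eq_prod_roots, norm_mul, hs.natDegree_eq_card_roots]
  refine mul_le_mul_of_nonneg_left ?_ (norm_nonneg _)
  replace h : ∀ z ∈ p.roots, ε ≤ ‖x - z‖ := fun z hz => h z (Polynomial.isRoot_of_mem_roots hz)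
  generalize p.roots = s at h
  induction s using Multiset.induction_on with
  | empty => simp
  | cons a s ih =>
    simp only [Multiset.card_cons, Multiset.map_cons, Multiset.prod_cons, norm_mul, pow_succ']
    exact mul_le_mul (h a (by simp)) (ih fun z hz => h z (by simp [hz])) (by positivity)
      (norm_nonneg _)

namespace MvPolynomial

/-- A zero of a bivariate polynomial over `ℂ` whose leading coefficient in the first variable is
constant is never isolated. -/
lemma exists_ne_eval_eq_zero_of_isUnit_leadingCoeff {h : MvPolynomial (Fin 2) ℂ}
    (hl : IsUnit (finSuccEquiv ℂ 1 h).leadingCoeff) {p : ℂ × ℂ} (hp : eval ![p.1, p.2] h = 0)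
    {U : Set (ℂ × ℂ)} (hU : U ∈ nhds p) :
    ∃ q ∈ U, q ≠ p ∧ eval ![q.1, q.2] h = 0 := by
  obtain ⟨c, hc, hcl⟩ := (isUnit_iff_eq_C_of_isReduced).mp hl
  set H := finSuccEquiv ℂ 1 h
  have hev (x y : ℂ) : eval ![x, y] h = (H.map (eval ![y])).eval x :=
    eval_eq_eval_mv_eval' ![y] x h
  have hne (y : ℂ) : eval ![y] H.leadingCoeff ≠ 0 := by
    rw [hcl, eval_C]; exact hc.ne_zero
  have hlead (y : ℂ) : (H.map (eval ![y])).leadingCoeff = c := by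
    rw [Polynomial.leadingCoeff_map_of_leadingCoeff_ne_zero _ (hne y), hcl, eval_C]
  have hdeg (y : ℂ) : (H.map (eval ![y])).natDegree = H.natDegree :=
    Polynomial.natDegree_map_of_leadingCoeff_ne_zero _ (hne y)
  obtain ⟨ε, hε, hball⟩ := Metric.mem_nhds_iff.mp hU
  have hcont : Continuous fun y => eval ![p.1, y] h :=
    (continuous_eval h).comp (continuous_pi fun i => by fin_cases i <;> simp <;> fun_prop)
  have hsmall : ∀ᶠ y in nhds p.2, ‖eval ![p.1, y] h‖ < ‖c‖ * ε ^ H.natDegree := by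
    refine hcont.norm.continuousAt.eventually_lt continuousAt_const ?_
    rw [hp, norm_zero]
    have := norm_pos_iff.mpr hc.ne_zero
    positivity
  have hnear : ∀ᶠ y in nhds p.2, dist y p.2 < ε := Metric.ball_mem_nhds _ hε
  obtain ⟨y, ⟨hy1, hy2⟩, hy3⟩ :=
    ((((hsmall.and hnear).filter_mono nhdsWithin_le_nhds).and
      (self_mem_nhdsWithin (a := p.2) (s := {p.2}ᶜ))).exists)
  obtain ⟨x, hx, hxp⟩ : ∃ x, (H.map (eval ![y])).IsRoot x ∧ ‖p.1 - x‖ < ε := by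
    by_contra! hcon
    have := Polynomial.norm_leadingCoeff_mul_pow_le_norm_eval hε.le hcon
    rw [hlead, hdeg, ← hev] at this
    exact absurd hy1 this.not_gt
  refine ⟨(x, y), hball ?_, fun h => hy3 (congrArg Prod.snd h), ?_⟩
  · rw [Metric.mem_ball, Prod.dist_eq, max_lt_iff]
    exact ⟨by rwa [dist_comm, dist_eq_norm], hy2⟩
  · rw [hev]; exact hx

lemma degreeOf_det_le {σ R ι : Type*} [CommRing R] [Fintype ι] [DecidableEq ι] (i : σ)
    (M : Matrix ι ι (MvPolynomial σ R)) (w : ι → ℕ) (h : ∀ a b, (M a b).degreeOf i ≤ w a) :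
    M.det.degreeOf i ≤ ∑ a, w a := by
  rw [← det_transpose, det_apply]
  refine (degreeOf_sum_le _ _ _).trans (Finset.sup_le fun τ _ => ?_)
  have hprod : (∏ a, Mᵀ (τ a) a).degreeOf i ≤ ∑ a, w a :=
    (degreeOf_prod_le _ _ _).trans (Finset.sum_le_sum fun a _ => h a _)
  rcases Int.units_eq_one_or (Equiv.Perm.sign τ) with hs | hs <;> simp only [hs]
  · simpa using hprod
  · simpa [degreeOf, degrees_neg] using hprod

lemma totalDegree_det_le {σ R ι : Type*} [CommRing R] [Fintype ι] [DecidableEq ι]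
    (M : Matrix ι ι (MvPolynomial σ R)) (w : ι → ℕ) (h : ∀ a b, (M a b).totalDegree ≤ w a) :
    M.det.totalDegree ≤ ∑ a, w a := by
  rw [← det_transpose, det_apply]
  refine totalDegree_finsetSum_le fun τ _ => ?_
  have hprod : (∏ a, Mᵀ (τ a) a).totalDegree ≤ ∑ a, w a :=
    (totalDegree_finsetProd _ _).trans (Finset.sum_le_sum fun a _ => h a _)
  rcases Int.units_eq_one_or (Equiv.Perm.sign τ) with hs | hs <;> simp only [hs]
  · simpa using hprod
  · simpa using hprod

end MvPolynomial

namespace Matrix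

lemma trace_mul_adjugate_eq_sum_det_updateRow {R ι : Type*} [CommRing R] [Fintype ι]
    [DecidableEq ι] (N M : Matrix ι ι R) :
    (N * M.adjugate).trace = ∑ i, (M.updateRow i (N i)).det := by
  refine Finset.sum_congr rfl fun i _ => ?_
  rw [← det_transpose, ← updateCol_transpose, ← cramer_apply, cramer_eq_adjugate_mulVec,
    ← adjugate_transpose, diag_apply, mul_apply, mulVec, dotProduct]
  exact Finset.sum_congr rfl fun j _ => mul_comm _ _

lemma trace_mul_mul_adjugate_mul {R ι : Type*} [CommRing R] [Fintype ι]
    [DecidableEq ι] (S N M : Matrix ι ι R) :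
    ((S * N) * (S * M).adjugate).trace = S.det * (N * M.adjugate).trace := by
  rw [adjugate_mul_distrib, ← Matrix.mul_assoc, trace_mul_comm, ← Matrix.mul_assoc,
    ← Matrix.mul_assoc, adjugate_mul, Matrix.mul_assoc, smul_mul, Matrix.one_mul, trace_smul,
    smul_eq_mul]

lemma IsHermitian.exists_det_ne_zero_and_mul_row_eq_zero {ι : Type*} [Fintype ι] [DecidableEq ι]
    {C : Matrix ι ι ℂ} (hC : C.IsHermitian) :
    ∃ (S : Matrix ι ι ℂ) (s : Finset ι), S.det ≠ 0 ∧ s.card = C.rank ∧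
      ∀ i ∉ s, ∀ j, (S * C) i j = 0 := by
  have hU := Unitary.star_mul_self_of_mem hC.eigenvectorUnitary.2
  have h : star (hC.eigenvectorUnitary : Matrix ι ι ℂ) * C =
      diagonal (RCLike.ofReal ∘ hC.eigenvalues) *
        star (hC.eigenvectorUnitary : Matrix ι ι ℂ) := by
    refine (congrArg (star (hC.eigenvectorUnitary : Matrix ι ι ℂ) * ·) hC.spectral_theorem).trans ?_
    rw [Unitary.conjStarAlgAut_apply, ← Matrix.mul_assoc, ← Matrix.mul_assoc, hU, Matrix.one_mul]
  refine ⟨star (hC.eigenvectorUnitary : Matrix ι ι ℂ),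
    Finset.univ.filter fun i => hC.eigenvalues i ≠ 0, ?_, ?_, fun i hi j => ?_⟩
  · exact (isUnit_det_of_right_inverse hU).ne_zero
  · rw [hC.rank_eq_card_non_zero_eigs, Fintype.card_subtype]
  · have hi' : hC.eigenvalues i = 0 := by simpa using hi
    rw [h, diagonal_mul]
    simp [hi']

end Matrix

namespace Matrix

open MvPolynomial

variable {ι : Type*}

/-- The linear matrix pencil `A - λ B - μ C` with polynomial entries, where `λ = X 0` and
`μ = X 1`. -/
noncomputable def pencil (A B C : Matrix ι ι ℂ) : Matrix ι ι (MvPolynomial (Fin 2) ℂ) :=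
  A.map MvPolynomial.C - (X 0 : MvPolynomial (Fin 2) ℂ) • B.map MvPolynomial.C -
    (X 1 : MvPolynomial (Fin 2) ℂ) • C.map MvPolynomial.C

lemma pencil_apply (A B C : Matrix ι ι ℂ) (i j : ι) :
    pencil A B C i j = MvPolynomial.C (A i j) - X 0 * MvPolynomial.C (B i j) -
      X 1 * MvPolynomial.C (C i j) := rfl

lemma map_eval_pencil (A B C : Matrix ι ι ℂ) (x y : ℂ) :
    (pencil A B C).map (eval ![x, y]) = A - x • B - y • C := by
  ext i j
  simp [pencil_apply]

lemma totalDegree_pencil_le (A B C : Matrix ι ι ℂ) (i j : ι) :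
    (pencil A B C i j).totalDegree ≤ 1 := by
  have h (k : Fin 2) (c : ℂ) : (X k * MvPolynomial.C c).totalDegree ≤ 1 :=
    (totalDegree_mul _ _).trans (by simp)
  rw [pencil_apply]
  exact (totalDegree_sub _ _).trans
    (max_le ((totalDegree_sub _ _).trans (max_le (by simp) (h _ _))) (h _ _))

lemma degreeOf_pencil_le_one (A B C : Matrix ι ι ℂ) (i j : ι) (k : Fin 2) :
    (pencil A B C i j).degreeOf k ≤ 1 :=
  (degreeOf_le_totalDegree _ _).trans (totalDegree_pencil_le A B C i j)

lemma degreeOf_pencil_eq_zero {A B C : Matrix ι ι ℂ} {i j : ι} (h : C i j = 0) :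
    (pencil A B C i j).degreeOf 1 = 0 := by
  rw [pencil_apply, h, map_zero, mul_zero, sub_zero, ← Nat.le_zero]
  refine (degreeOf_sub_le _ _ _).trans (max_le (by simp) ((degreeOf_mul_le _ _ _).trans ?_))
  rw [degreeOf_X_of_ne (by decide)]
  simp

lemma map_C_mul_pencil [Fintype ι] (S A B C : Matrix ι ι ℂ) :
    S.map MvPolynomial.C * pencil A B C = pencil (S * A) (S * B) (S * C) := by
  simp only [pencil, Matrix.mul_sub, Matrix.mul_smul, Matrix.map_mul]

variable [Fintype ι] [DecidableEq ι]

lemma eval_det_pencil (A B C : Matrix ι ι ℂ) (x y : ℂ) :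
    eval ![x, y] (pencil A B C).det = (A - x • B - y • C).det := by
  rw [RingHom.map_det, RingHom.mapMatrix_apply, map_eval_pencil]

lemma eval_trace_mul_adjugate_pencil (A B C P Q : Matrix ι ι ℂ) (x y : ℂ) :
    eval ![x, y] ((pencil P 0 Q * (pencil A B C).adjugate).trace) =
      ((P - y • Q) * (A - x • B - y • C).adjugate).trace := by
  rw [AddMonoidHom.map_trace, Matrix.map_mul]
  have h : (pencil A B C).adjugate.map (eval ![x, y]) = (A - x • B - y • C).adjugate := by
    rw [← map_eval_pencil]
    exact (eval ![x, y]).map_adjugate (pencil A B C)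
  exact congrArg trace (congrArg₂ (· * ·) (by simp [map_eval_pencil]) h)

lemma totalDegree_det_pencil_le (A B C : Matrix ι ι ℂ) :
    (pencil A B C).det.totalDegree ≤ Fintype.card ι := by
  simpa using totalDegree_det_le (pencil A B C) (fun _ => 1) (totalDegree_pencil_le A B C)

lemma totalDegree_trace_mul_adjugate_pencil_le (A B C P Q : Matrix ι ι ℂ) :
    (pencil P 0 Q * (pencil A B C).adjugate).trace.totalDegree ≤ Fintype.card ι := by
  rw [trace_mul_adjugate_eq_sum_det_updateRow]
  refine totalDegree_finsetSum_le fun i _ => ?_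
  refine (totalDegree_det_le _ (fun _ => 1) fun a b => ?_).trans (by simp)
  rw [updateRow_apply]
  split_ifs <;> exact totalDegree_pencil_le ..

lemma IsHermitian.degreeOf_det_pencil_le (A B : Matrix ι ι ℂ) {C : Matrix ι ι ℂ}
    (hC : C.IsHermitian) : (pencil A B C).det.degreeOf 1 ≤ C.rank := by
  obtain ⟨S, s, hS, hs, hrow⟩ := hC.exists_det_ne_zero_and_mul_row_eq_zero
  have hdet : (S.map MvPolynomial.C).det = (MvPolynomial.C S.det : MvPolynomial (Fin 2) ℂ) :=
    (RingHom.map_det MvPolynomial.C S).symm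
  rw [← degreeOf_C_mul 1 S.det (mem_nonZeroDivisors_of_ne_zero hS), ← hdet, ← det_mul,
    map_C_mul_pencil, ← hs]
  refine (degreeOf_det_le _ _ (fun i => if i ∈ s then 1 else 0) fun i j => ?_).trans (by simp)
  split_ifs with hi
  · exact degreeOf_pencil_le_one ..
  · exact (degreeOf_pencil_eq_zero (hrow i hi j)).le

lemma IsHermitian.degreeOf_trace_mul_adjugate_pencil_le (A B P Q : Matrix ι ι ℂ)
    {C : Matrix ι ι ℂ} (hC : C.IsHermitian) :
    (pencil P 0 Q * (pencil A B C).adjugate).trace.degreeOf 1 ≤ C.rank + 1 := by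
  obtain ⟨S, s, hS, hs, hrow⟩ := hC.exists_det_ne_zero_and_mul_row_eq_zero
  have hdet : (S.map MvPolynomial.C).det = (MvPolynomial.C S.det : MvPolynomial (Fin 2) ℂ) :=
    (RingHom.map_det MvPolynomial.C S).symm
  rw [← degreeOf_C_mul 1 S.det (mem_nonZeroDivisors_of_ne_zero hS), ← hdet,
    ← trace_mul_mul_adjugate_mul, map_C_mul_pencil, map_C_mul_pencil, ← hs,
    trace_mul_adjugate_eq_sum_det_updateRow]
  refine (degreeOf_sum_le _ _ _).trans (Finset.sup_le fun k _ => ?_)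
  refine (degreeOf_det_le _ _
    (fun i => (if i ∈ s then 1 else 0) + if i = k then 1 else 0) fun i j => ?_).trans
      (by simp [Finset.sum_add_distrib])
  rw [updateRow_apply]
  rcases eq_or_ne i k with rfl | hik
  · rw [if_pos rfl, if_pos rfl]
    exact (degreeOf_pencil_le_one ..).trans (by lia)
  · rw [if_neg hik, if_neg hik, add_zero]
    split_ifs with hi
    · exact degreeOf_pencil_le_one ..
    · exact (degreeOf_pencil_eq_zero (hrow i hi j)).le

lemma isUnit_leadingCoeff_finSuccEquiv_det_pencil (A C : Matrix ι ι ℂ) {B : Matrix ι ι ℂ}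
    (hB : B.det ≠ 0) : IsUnit (finSuccEquiv ℂ 1 (pencil A B C).det).leadingCoeff := by
  have hmap : (finSuccEquiv ℂ 1).mapMatrix (pencil A B C) =
      (Polynomial.X : Polynomial (MvPolynomial (Fin 1) ℂ)) •
        ((-B).map MvPolynomial.C : Matrix ι ι (MvPolynomial (Fin 1) ℂ)).map Polynomial.C +
        (A.map MvPolynomial.C - (X 0 : MvPolynomial (Fin 1) ℂ) • C.map MvPolynomial.C :
          Matrix ι ι (MvPolynomial (Fin 1) ℂ)).map Polynomial.C := by
    have h1 : finSuccEquiv ℂ 1 (X 1) = Polynomial.C (X 0) := finSuccEquiv_X_succ (j := 0)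
    ext1 i j
    simp only [AlgEquiv.mapMatrix_apply, map_apply, pencil_apply, map_sub, map_mul,
      finSuccEquiv_X_zero, h1, add_apply, smul_apply, sub_apply, neg_apply, smul_eq_mul,
      map_neg]
    have hc (c : ℂ) : finSuccEquiv ℂ 1 (MvPolynomial.C c) =
        Polynomial.C (MvPolynomial.C c) := by simp [finSuccEquiv_apply]
    rw [hc, hc, hc]
    ring
  have hcoeff : ((finSuccEquiv ℂ 1) (pencil A B C).det).coeff (Fintype.card ι) =
      MvPolynomial.C (-B).det := by
    rw [AlgEquiv.map_det, hmap, Polynomial.coeff_det_X_add_C_card]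
    exact (RingHom.map_det MvPolynomial.C (-B)).symm
  have hne : (-B).det ≠ 0 := by
    rw [det_neg]; exact mul_ne_zero (pow_ne_zero _ (by simp)) hB
  have hdeg : ((finSuccEquiv ℂ 1) (pencil A B C).det).natDegree = Fintype.card ι := by
    refine le_antisymm ?_ (Polynomial.le_natDegree_of_ne_zero ?_)
    · rw [AlgEquiv.map_det, hmap]
      exact Polynomial.natDegree_det_X_add_C_le _ _
    · rw [hcoeff]; simpa using hne
  rw [Polynomial.leadingCoeff, hdeg, hcoeff]
  exact (isUnit_iff_ne_zero.mpr hne).map _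

end Matrix

namespace MvPolynomial

lemma le_of_add_mul_le {n r a b m d c : ℕ} (ham : a ≤ m) (har : a ≤ r) (hbr : b ≤ r + 1)
    (hmn : m ≤ n) (hdn : d ≤ n) (hrn : r + 1 ≤ n) (h : c + a * b ≤ a * d + m * b) :
    c ≤ n * (2 * r + 1) - r * (r + 1) := by
  refine Nat.le_sub_of_add_le ?_
  obtain ⟨x, rfl⟩ := Nat.exists_eq_add_of_le har
  obtain ⟨y, rfl⟩ := Nat.exists_eq_add_of_le (ham.trans hmn)
  have h1 : a * d ≤ a * (a + y) := Nat.mul_le_mul_left _ hdn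
  have h2 : m * b ≤ (a + y) * b := Nat.mul_le_mul_right _ hmn
  have h3 : y * b ≤ y * (a + x + 1) := Nat.mul_le_mul_left _ hbr
  have h4 : x * (x + 1) ≤ x * y := Nat.mul_le_mul_left _ (by lia)
  linarith

/-- The isolated common zeros of two bivariate polynomials, the first of which has a constant
leading coefficient in the first variable, satisfy the Bézout bound associated with the total
degrees and the degrees in the second variable. -/
theorem card_isolated_le {f g : MvPolynomial (Fin 2) ℂ}
    (hf : IsUnit (finSuccEquiv ℂ 1 f).leadingCoeff) {n r : ℕ} (hrn : r + 1 ≤ n)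
    (hfn : f.totalDegree ≤ n) (hgn : g.totalDegree ≤ n) (hfr : f.degreeOf 1 ≤ r)
    (hgr : g.degreeOf 1 ≤ r + 1) (S : Finset (ℂ × ℂ))
    (hS : ∀ p ∈ S, ∃ U ∈ nhds p,
      U ∩ {q : ℂ × ℂ | eval ![q.1, q.2] f = 0 ∧ eval ![q.1, q.2] g = 0} = {p}) :
    S.card ≤ n * (2 * r + 1) - r * (r + 1) := by
  have hf0 : f ≠ 0 := by rintro rfl; simp at hf
  obtain ⟨F, G, h, hFG, rfl, rfl⟩ := UniqueFactorizationMonoid.exists_reduced_factors f hf0 g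
  have hh0 : h ≠ 0 := left_ne_zero_of_mul hf0
  have hF0 : F ≠ 0 := right_ne_zero_of_mul hf0
  have hl : IsUnit (finSuccEquiv ℂ 1 h).leadingCoeff := by
    rw [map_mul, Polynomial.leadingCoeff_mul] at hf
    exact isUnit_of_mul_isUnit_left hf
  have hz : ∀ p ∈ S, eval ![p.1, p.2] F = 0 ∧ eval ![p.1, p.2] G = 0 := by
    intro p hp
    obtain ⟨U, hU, hUp⟩ := hS p hp
    have hpz := (hUp.symm ▸ Set.mem_singleton p : p ∈ U ∩ _).2
    simp only [Set.mem_ofPred_eq, map_mul, mul_eq_zero] at hpz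
    have hhp : eval ![p.1, p.2] h ≠ 0 := by
      intro hhp
      obtain ⟨q, hqU, hqp, hq⟩ := exists_ne_eval_eq_zero_of_isUnit_leadingCoeff hl hhp hU
      have : q ∈ ({p} : Set (ℂ × ℂ)) := hUp ▸ ⟨hqU, by simp [hq]⟩
      exact hqp this
    exact ⟨hpz.1.resolve_left hhp, hpz.2.resolve_left hhp⟩
  rcases eq_or_ne G 0 with rfl | hG0
  · have hFu : IsUnit F := hFG dvd_rfl (dvd_zero F)
    have : S = ∅ := Finset.eq_empty_of_forall_notMem fun p hp =>
      (hFu.map (eval ![p.1, p.2])).ne_zero (hz p hp).1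
    simp [this]
  have hinj : Function.Injective fun p : ℂ × ℂ => (![p.1, p.2] : Fin 2 → ℂ) := fun p q hpq =>
    Prod.ext (congrFun hpq 0) (congrFun hpq 1)
  have hzero : ∀ q ∈ S.map ⟨_, hinj⟩, eval q F = 0 ∧ eval q G = 0 := fun q hq => by
    obtain ⟨p, hp, rfl⟩ := Finset.mem_map.mp hq
    exact hz p hp
  have key := card_add_mul_le_of_isRelPrime hG0 hFG (S.map ⟨_, hinj⟩)
    (fun q hq => (hzero q hq).1) (fun q hq => (hzero q hq).2)
  rw [Finset.card_map] at key
  rw [totalDegree_mul_of_isDomain hh0 hF0] at hfn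
  rw [totalDegree_mul_of_isDomain hh0 hG0] at hgn
  rw [degreeOf_mul_eq hh0 hF0] at hfr
  rw [degreeOf_mul_eq hh0 hG0] at hgr
  have hFr := degreeOf_le_totalDegree F 1
  exact le_of_add_mul_le hFr (by lia) (by lia) (by lia) (by lia) hrn key

end MvPolynomial

theorem stmt_18 (n : ℕ) (hn : 0 < n)
    (A B C P Q : Matrix (Fin n) (Fin n) ℂ)
    (hA : A.IsHermitian) (hC : C.IsHermitian) (hP : P.IsHermitian)
    (hB : B.PosDef) (hQ : Q.PosDef)
    (hrankC : C.rank < n - 1) :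
    {p : ℂ × ℂ | ((A - p.1 • B - p.2 • C).det = 0 ∧
        ((P - p.2 • Q) * (A - p.1 • B - p.2 • C).adjugate).trace = 0) ∧
      p.1 ≠ 0 ∧ p.2 ≠ 0 ∧
      ∃ U ∈ nhds p, U ∩ {q : ℂ × ℂ | (A - q.1 • B - q.2 • C).det = 0 ∧
        ((P - q.2 • Q) * (A - q.1 • B - q.2 • C).adjugate).trace = 0} = {p}}.Finite ∧
    {p : ℂ × ℂ | ((A - p.1 • B - p.2 • C).det = 0 ∧
        ((P - p.2 • Q) * (A - p.1 • B - p.2 • C).adjugate).trace = 0) ∧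
      p.1 ≠ 0 ∧ p.2 ≠ 0 ∧
      ∃ U ∈ nhds p, U ∩ {q : ℂ × ℂ | (A - q.1 • B - q.2 • C).det = 0 ∧
        ((P - q.2 • Q) * (A - q.1 • B - q.2 • C).adjugate).trace = 0} = {p}}.ncard ≤
      n * (2 * C.rank + 1) - C.rank * (C.rank + 1) := by
  set I := {p : ℂ × ℂ | ((A - p.1 • B - p.2 • C).det = 0 ∧
        ((P - p.2 • Q) * (A - p.1 • B - p.2 • C).adjugate).trace = 0) ∧
      p.1 ≠ 0 ∧ p.2 ≠ 0 ∧
      ∃ U ∈ nhds p, U ∩ {q : ℂ × ℂ | (A - q.1 • B - q.2 • C).det = 0 ∧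
        ((P - q.2 • Q) * (A - q.1 • B - q.2 • C).adjugate).trace = 0} = {p}}
  have hbound (S : Finset (ℂ × ℂ)) (hS : ↑S ⊆ I) :
      S.card ≤ n * (2 * C.rank + 1) - C.rank * (C.rank + 1) := by
    refine MvPolynomial.card_isolated_le (f := (pencil A B C).det)
      (g := (pencil P 0 Q * (pencil A B C).adjugate).trace)
      (isUnit_leadingCoeff_finSuccEquiv_det_pencil A C hB.det_pos.ne') (by lia)
      (by simpa using totalDegree_det_pencil_le A B C)
      (by simpa using totalDegree_trace_mul_adjugate_pencil_le A B C P Q)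
      (hC.degreeOf_det_pencil_le A B) (hC.degreeOf_trace_mul_adjugate_pencil_le A B P Q)
      S fun p hp => ?_
    simp only [eval_det_pencil, eval_trace_mul_adjugate_pencil]
    exact (hS hp).2.2.2
  have hfin : I.Finite := by
    by_contra hinf
    obtain ⟨S, hS, hcard⟩ := Set.Infinite.exists_subset_card_eq hinf
      (n * (2 * C.rank + 1) - C.rank * (C.rank + 1) + 1)
    have := hbound S hS
    lia
  refine ⟨hfin, ?_⟩
  rw [Set.ncard_eq_toFinset_card _ hfin]
  exact hbound _ (by simp)
end

section
/- Assume Δ₀ is nonsingular and assume that the set E = {(λ,μ) ∈ ℂ × ℂ : ∃ z ≠ 0, Δ₁ *ᵥ z = λ·(Δ₀ *ᵥ z) and Δ₂ *ᵥ z = μ·(Δ₀ *ᵥ z)} has exactly n·(2n−1) elements. Then for every (λ,μ) ∈ E and every nonzero z with Δ₁ *ᵥ z = λ·(Δ₀ *ᵥ z) and Δ₂ *ᵥ z = μ·(Δ₀ *ᵥ z), at least one of the following holds: (i) z ∈ 𝒵, i.e. z = vec of a (2n−1)×n block matrix whose bottom n×n block is symmetric; or (ii) there exists a nonzero y ∈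 ℂ^{n−1} with (M(λ,μ)ᴴ * R) *ᵥ y = 0, i.e. yᴴ Rᴴ M(λ,μ) = 0. -/
open Matrix
open scoped ComplexOrder Kronecker

/-- If the operator determinant `B ⊗ C' - C ⊗ B'` of a two-parameter pencil is nonsingular, then a
common kernel vector of `M ⊗ C' - C ⊗ M'` and `B ⊗ M' - M ⊗ B'` is annihilated by both `M ⊗ 1` and
`1 ⊗ M'`. -/
theorem kronecker_one_mulVec_eq_zero {m p K : Type*} [Fintype m] [DecidableEq m] [Fintype p]
    [DecidableEq p] [Field K] (M B C : Matrix m m K) (M' B' C' : Matrix p p K)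
    (hdet : (B ⊗ₖ C' - C ⊗ₖ B').det ≠ 0) (z : m × p → K)
    (h₁ : (M ⊗ₖ C' - C ⊗ₖ M') *ᵥ z = 0) (h₂ : (B ⊗ₖ M' - M ⊗ₖ B') *ᵥ z = 0) :
    (M ⊗ₖ (1 : Matrix p p K)) *ᵥ z = 0 ∧ ((1 : Matrix m m K) ⊗ₖ M') *ᵥ z = 0 := by
  set adj := fromBlocks ((1 : Matrix m m K) ⊗ₖ C') (-(C ⊗ₖ (1 : Matrix p p K)))
    (-((1 : Matrix m m K) ⊗ₖ B')) (B ⊗ₖ (1 : Matrix p p K)) with hadj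
  have hmul : adj * fromBlocks (B ⊗ₖ (1 : Matrix p p K)) (C ⊗ₖ (1 : Matrix p p K))
      ((1 : Matrix m m K) ⊗ₖ B') ((1 : Matrix m m K) ⊗ₖ C') =
      fromBlocks (B ⊗ₖ C' - C ⊗ₖ B') 0 0 (B ⊗ₖ C' - C ⊗ₖ B') := by
    simp only [hadj, fromBlocks_multiply, neg_mul, ← mul_kronecker_mul, one_mul, mul_one]
    congr 1 <;> abel
  have hunit : adj.det ≠ 0 := by
    intro h0
    have h := congrArg det hmul
    rw [det_mul, h0, zero_mul, det_fromBlocks_zero₂₁] at h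
    exact mul_ne_zero hdet hdet h.symm
  have hker : adj *ᵥ Sum.elim ((M ⊗ₖ (1 : Matrix p p K)) *ᵥ z)
      (((1 : Matrix m m K) ⊗ₖ M') *ᵥ z) = 0 := by
    rw [hadj, fromBlocks_mulVec]
    simp only [Sum.elim_comp_inl, Sum.elim_comp_inr, mulVec_mulVec, neg_mul,
      ← mul_kronecker_mul, one_mul, mul_one, ← add_mulVec, ← sub_eq_add_neg, neg_add_eq_sub,
      h₁, h₂]
    exact funext (Sum.rec (fun _ => rfl) fun _ => rfl)
  have h0 := eq_zero_of_mulVec_eq_zero hunit hker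
  exact ⟨funext fun i => congrFun h0 (Sum.inl i), funext fun i => congrFun h0 (Sum.inr i)⟩

/-- The kernel of a matrix with `n` columns whose conjugate transpose is injective on
`n - 1` coordinates is spanned by a single nonzero vector. -/
theorem exists_ker_mulVec_eq_span {n : ℕ} (hn : 0 < n) (N : Matrix (Fin (n - 1)) (Fin n) ℂ)
    (hN : ∀ y, Nᴴ *ᵥ y = 0 → y = 0) :
    ∃ x : Fin n → ℂ, x ≠ 0 ∧ ∀ v, N *ᵥ v = 0 → ∃ c : ℂ, c • x = v := by
  have hrank : N.rank = n - 1 := by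
    have hinj : Function.Injective Nᴴ.mulVecLin :=
      (injective_iff_map_eq_zero Nᴴ.mulVecLin).2 fun y hy => hN y hy
    rw [← rank_conjTranspose, rank, LinearMap.finrank_range_of_inj hinj]
    simp
  have hfin : Module.finrank ℂ (LinearMap.ker N.mulVecLin) = 1 := by
    have h := LinearMap.finrank_range_add_finrank_ker N.mulVecLin
    rw [Module.finrank_fin_fun] at h
    rw [rank] at hrank
    omega
  obtain ⟨⟨x, hx⟩, hx0, hspan⟩ := finrank_eq_one_iff'.1 hfin
  refine ⟨x, fun h => hx0 (Subtype.ext h), fun v hv => ?_⟩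
  obtain ⟨c, hc⟩ := hspan ⟨v, hv⟩
  exact ⟨c, congrArg Subtype.val hc⟩

/-- A square matrix whose rows and columns all lie on one line is symmetric. -/
theorem transpose_eq_self_of_forall_mem_line {m K : Type*} [Field K] (V : Matrix m m K) {x : m → K}
    (hx : x ≠ 0) (hrow : ∀ i, ∃ c : K, c • x = V i) (hcol : ∀ j, ∃ c : K, c • x = Vᵀ j) :
    Vᵀ = V := by
  choose r hr using hrow
  choose s hs using hcol
  obtain ⟨k, hk⟩ := Function.ne_iff.1 hx
  have hr' : ∀ i j, V i j = r i * x j := fun i j => (congrFun (hr i) j).symm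
  have hs' : ∀ i j, V i j = s j * x i := fun i j => (congrFun (hs j) i).symm
  have hrx : ∀ i, r i = s k / x k * x i := fun i => by
    have h := (hr' i k).symm.trans (hs' i k)
    rw [div_mul_eq_mul_div]
    exact (eq_div_iff hk).2 h
  ext i j
  rw [transpose_apply, hr', hr', hrx i, hrx j]
  ring

theorem stmt_19 (n : ℕ) (hn : 0 < n)
    (A B C P Q : Matrix (Fin n) (Fin n) ℂ)
    (hA : A.IsHermitian) (hC : C.IsHermitian) (hP : P.IsHermitian)
    (hB : B.PosDef) (hQ : Q.PosDef)
    (R : Matrix (Fin n) (Fin (n - 1)) ℂ) (hR : Function.Injective R.mulVec)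
    (Ahat : Matrix (Fin (n - 1) ⊕ Fin n) (Fin (n - 1) ⊕ Fin n) ℂ)
    (hAhat : Ahat = Matrix.fromBlocks 0 (Rᴴ * A) (A * R) P)
    (Bhat : Matrix (Fin (n - 1) ⊕ Fin n) (Fin (n - 1) ⊕ Fin n) ℂ)
    (hBhat : Bhat = Matrix.fromBlocks 0 (Rᴴ * B) (B * R) 0)
    (Chat : Matrix (Fin (n - 1) ⊕ Fin n) (Fin (n - 1) ⊕ Fin n) ℂ)
    (hChat : Chat = Matrix.fromBlocks 0 (Rᴴ * C) (C * R) Q)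
    (Δ₀ Δ₁ Δ₂ : Matrix (Fin n × (Fin (n - 1) ⊕ Fin n)) (Fin n × (Fin (n - 1) ⊕ Fin n)) ℂ)
    (hΔ₀ : Δ₀ = B ⊗ₖ Chat - C ⊗ₖ Bhat)
    (hΔ₁ : Δ₁ = A ⊗ₖ Chat - C ⊗ₖ Ahat)
    (hΔ₂ : Δ₂ = B ⊗ₖ Ahat - A ⊗ₖ Bhat)
    (hΔ₀det : Δ₀.det ≠ 0)
    (hcard : {p : ℂ × ℂ | ∃ z : Fin n × (Fin (n - 1) ⊕ Fin n) → ℂ, z ≠ 0 ∧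
        Δ₁.mulVec z = p.1 • Δ₀.mulVec z ∧
        Δ₂.mulVec z = p.2 • Δ₀.mulVec z}.encard = (n * (2 * n - 1) : ℕ)) :
    ∀ lam μ : ℂ, ∀ z : Fin n × (Fin (n - 1) ⊕ Fin n) → ℂ, z ≠ 0 →
      Δ₁.mulVec z = lam • Δ₀.mulVec z → Δ₂.mulVec z = μ • Δ₀.mulVec z →
      (∃ (W : Matrix (Fin (n - 1)) (Fin n) ℂ) (V : Matrix (Fin n) (Fin n) ℂ),
          Vᵀ = V ∧ ∀ p : Fin n × (Fin (n - 1) ⊕ Fin n),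
            z p = Sum.elim (fun i => W i p.1) (fun i => V i p.1) p.2) ∨
      (∃ y : Fin (n - 1) → ℂ, y ≠ 0 ∧
        ((A - lam • B - μ • C)ᴴ * R).mulVec y = 0) := by
  intro lam μ z _ h₁ h₂
  by_cases hy : ∃ y : Fin (n - 1) → ℂ, y ≠ 0 ∧ ((A - lam • B - μ • C)ᴴ * R) *ᵥ y = 0
  · exact Or.inr hy
  refine Or.inl ⟨fun i j => z (j, Sum.inl i), fun i j => z (j, Sum.inr i), ?_, ?_⟩
  swap
  · rintro ⟨j, i | i⟩ <;> rfl
  set M := A - lam • B - μ • C with hM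
  set M' := Ahat - lam • Bhat - μ • Chat with hM'
  have e₁ : M ⊗ₖ Chat - C ⊗ₖ M' = Δ₁ - lam • Δ₀ := by
    rw [hΔ₀, hΔ₁, hM, hM']
    ext ⟨i, k⟩ ⟨j, l⟩
    simp only [Matrix.sub_apply, Matrix.smul_apply, kronecker_apply, smul_eq_mul]
    ring
  have e₂ : B ⊗ₖ M' - M ⊗ₖ Bhat = Δ₂ - μ • Δ₀ := by
    rw [hΔ₀, hΔ₂, hM, hM']
    ext ⟨i, k⟩ ⟨j, l⟩
    simp only [Matrix.sub_apply, Matrix.smul_apply, kronecker_apply, smul_eq_mul]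
    ring
  obtain ⟨k₁, k₂⟩ := kronecker_one_mulVec_eq_zero M B C M' Bhat Chat (hΔ₀ ▸ hΔ₀det) z
    (by rw [e₁, sub_mulVec, smul_mulVec, h₁, sub_self])
    (by rw [e₂, sub_mulVec, smul_mulVec, h₂, sub_self])
  obtain ⟨x, hx, hspan⟩ := exists_ker_mulVec_eq_span hn (Rᴴ * M) fun y h => by
    by_contra hy0
    rw [conjTranspose_mul, conjTranspose_conjTranspose] at h
    exact hy ⟨y, hy0, h⟩
  refine transpose_eq_self_of_forall_mem_line _ hx (fun i => hspan _ ?_) fun j => hspan _ ?_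
  · have h : M *ᵥ (fun j => z (j, Sum.inr i)) = 0 := by
      ext l
      have := congrFun k₁ (l, Sum.inr i)
      simpa [mulVec, dotProduct, Fintype.sum_prod_type, kronecker_apply, one_apply] using this
    rw [← mulVec_mulVec, h, mulVec_zero]
  · have hblock : M' = fromBlocks 0 (Rᴴ * M) (M * R) (P - μ • Q) := by
      rw [hM', hM, hAhat, hBhat, hChat]
      simp only [fromBlocks_smul, sub_eq_add_neg, fromBlocks_neg, fromBlocks_add]
      congr 1 <;> simp [Matrix.mul_add, Matrix.add_mul]
    have h : (Rᴴ * M) *ᵥ (fun i => z (j, Sum.inr i)) = 0 := by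
      ext l
      have := congrFun k₂ (j, Sum.inl l)
      rw [hblock] at this
      simpa [mulVec, dotProduct, Fintype.sum_prod_type, kronecker_apply, one_apply] using this
    exact h
end
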